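/- The only Padovan numbers that are concatenations of two distinct repdigits are 12, 16, 21, 28, 37, 49, 65, 86, 114, and 200. More precisely, if n ≥ 0, d₁, d₂ ∈ {0,…,9} with d₁ ≠ d₂ and d₁ > 0, and ℓ₁, ℓ₂ ≥ 1 are integers satisfying P_n = d₁·((10^{ℓ₁} − 1)/9)·10^{ℓ₂} + d₂·((10^{ℓ₂} − 1)/9), then P_n ∈ {12, 16, 21, 28, 37, 49, 65, 86, 114, 200}. -/

import Mathlib

/-- The Padovan sequence: `P 0 = 0`, `P 1 = 1`, `P 2 = 1`, `P (n+3) = P (n+1) + P n`. -/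
def padovan : ℕ → ℕ
  | 0 => 0
  | 1 => 1
  | 2 => 1
  | n + 3 => padovan (n + 1) + padovan n

namespace PadTS
open Polynomial

/-- The operator `T d/dT`. -/
noncomputable def dlt (f : ℝ[X]) : ℝ[X] := X * derivative f

lemma dlt_dvd (θ : ℝ) (m : ℕ) (f : ℝ[X]) (h : (X - C θ) ^ m ∣ f) :
    (X - C θ) ^ (m - 1) ∣ dlt f :=
  Dvd.dvd.mul_left (pow_sub_one_dvd_derivative_of_pow_dvd h) _

lemma dlt_iter_dvd (θ : ℝ) (m : ℕ) (f : ℝ[X]) (h : (X - C θ) ^ m ∣ f) (s : ℕ) :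
    (X - C θ) ^ (m - s) ∣ dlt^[s] f := by
  induction s with
  | zero => simpa using h
  | succ s ih =>
    rw [Function.iterate_succ_apply', ← Nat.sub_sub]
    exact dlt_dvd _ _ _ ih

lemma dlt_monomial (w : ℕ) (a : ℝ) : dlt (C a * X ^ w) = C (a * w) * X ^ w := by
  unfold dlt
  rw [derivative_C_mul_X_pow]
  rcases w with _ | w
  · simp
  · simp only [Nat.add_sub_cancel]
    rw [pow_succ]; ring

lemma dlt_sum {ι : Type*} (s : Finset ι) (f : ι → ℝ[X]) :
    dlt (∑ i ∈ s, f i) = ∑ i ∈ s, dlt (f i) := by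
  unfold dlt; rw [derivative_sum, Finset.mul_sum]

lemma dlt_iter_sum {ι : Type*} (t : Finset ι) (a : ι → ℝ) (w : ι → ℕ) (s : ℕ) :
    dlt^[s] (∑ i ∈ t, C (a i) * X ^ (w i)) = ∑ i ∈ t, C (a i * (w i : ℝ) ^ s) * X ^ (w i) := by
  induction s with
  | zero => simp
  | succ s ih =>
    rw [Function.iterate_succ_apply', ih, dlt_sum]
    refine Finset.sum_congr rfl fun i _ => ?_
    rw [dlt_monomial, pow_succ, mul_assoc]

lemma transfer (θ : ℝ) (hθ : θ ≠ 0) (r : ℕ) (hr : 0 < r) (V : ℝ[X]) (hV : V ≠ 0) (m c : ℕ)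
    (h : (X - C θ) ^ m ∣ expand ℝ r V * X ^ c) : (X - C (θ ^ r)) ^ m ∣ V := by
  have hcop : IsCoprime ((X - C θ) ^ m) ((X : ℝ[X]) ^ c) := by
    apply IsCoprime.pow
    have := isCoprime_X_sub_C_of_isUnit_sub (R := ℝ) (a := θ) (b := 0) (by simpa using hθ)
    simpa using this
  have h1 := hcop.dvd_of_dvd_mul_right h
  obtain ⟨W, hW, hW'⟩ := V.exists_eq_pow_rootMultiplicity_mul_and_not_dvd hV (θ ^ r)
  set e := V.rootMultiplicity (θ ^ r)
  have hq : (X - C θ) * (∑ i ∈ Finset.range r, X ^ i * C θ ^ (r - 1 - i)) = X ^ r - C (θ ^ r) := by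
    rw [mul_comm, Commute.geom_sum₂_mul (Commute.all _ _), C_pow]
  set q : ℝ[X] := ∑ i ∈ Finset.range r, X ^ i * C θ ^ (r - 1 - i) with hqdef
  have hqe : q.eval θ ≠ 0 := by
    rw [hqdef, eval_finsetSum]
    have : ∀ i ∈ Finset.range r, (X ^ i * C θ ^ (r - 1 - i)).eval θ = θ ^ (r - 1) := by
      intro i hi
      have := Finset.mem_range.1 hi
      simp only [eval_mul, eval_pow, eval_X, eval_C]
      rw [← pow_add]; congr 1; omega
    rw [Finset.sum_congr rfl this]
    simp only [Finset.sum_const, Finset.card_range, nsmul_eq_mul]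
    exact mul_ne_zero (by exact_mod_cast hr.ne') (pow_ne_zero _ hθ)
  have hexp : expand ℝ r V = (X - C θ) ^ e * (q ^ e * expand ℝ r W) := by
    conv_lhs => rw [hW]
    rw [map_mul, map_pow, map_sub, expand_X, expand_C, ← hq, mul_pow]; ring
  have hR : ¬ (X - C θ) ∣ q ^ e * expand ℝ r W := by
    rw [dvd_iff_isRoot, IsRoot, eval_mul, eval_pow, expand_eval]
    refine mul_ne_zero (pow_ne_zero _ hqe) ?_
    rwa [dvd_iff_isRoot] at hW'
  have hme : m ≤ e := by
    by_contra hlt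
    push Not at hlt
    apply hR
    have h2 : (X - C θ) ^ (e + 1) ∣ (X - C θ) ^ e * (q ^ e * expand ℝ r W) :=
      (pow_dvd_pow _ hlt).trans (hexp ▸ h1)
    rw [pow_succ] at h2
    exact (mul_dvd_mul_iff_left (pow_ne_zero _ (X_sub_C_ne_zero θ))).1 h2
  rw [hW]
  exact (pow_dvd_pow _ hme).mul_right _

lemma det_dvd_of_col {k : ℕ} (G : Matrix (Fin k) (Fin k) ℝ[X]) (u : Fin k → ℝ) (j0 : Fin k)
    (hu : u j0 ≠ 0) (Q : ℝ[X]) (h : ∀ s, Q ∣ ∑ j, C (u j) * G s j) : Q ∣ G.det := by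
  choose v hv using h
  have h1 := Matrix.det_updateCol_sum G j0 (fun j => C (u j))
  have h2 : (fun s => ∑ i, C (u i) • G s i) = Q • v := by
    funext s
    simp only [smul_eq_mul, Pi.smul_apply]
    exact hv s
  rw [h2, Matrix.det_updateCol_smul] at h1
  have h3 : Q ∣ C (u j0) * G.det := ⟨_, by rw [h1]; rfl⟩
  have hunit : IsUnit (C (u j0)) := by simpa using hu
  exact (hunit.dvd_mul_left).1 h3

lemma natDegree_det_le' {k D : ℕ} (N : Matrix (Fin k) (Fin k) ℝ[X])
    (h : ∀ s j, (N s j).natDegree ≤ D) : N.det.natDegree ≤ k * D := by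
  rw [Matrix.det_apply]
  apply natDegree_sum_le_of_forall_le
  intro σ _
  refine (natDegree_smul_le _ _).trans ?_
  refine (natDegree_prod_le _ _).trans ?_
  refine (Finset.sum_le_sum (fun i _ => h _ _)).trans ?_
  simp

/-- Zero estimate, core version. -/
lemma zero_core (k A r M0 S : ℕ) (hr : 0 < r) (c : Fin k → ℕ)
    (hc : Function.Injective c) (hcr : ∀ j, c j < r) (p : ℕ → Fin k → ℝ)
    (hp : ∀ j, ∃ i < A, p i j ≠ 0) (hk : 0 < k) (θ : ℝ) (hθ : θ ≠ 0) (hθ1 : θ ^ r ≠ 1)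
    (u : Fin k → ℝ) (hu : ∀ j, u j ≠ 0) (hM : k ≤ M0) (hS : k ≤ S)
    (h1 : (X - C 1) ^ M0 ∣ ∑ j, ∑ i ∈ Finset.range A, C (p i j) * X ^ (r * i + c j))
    (h2 : (X - C θ) ^ S ∣ ∑ j, C (u j) * ∑ i ∈ Finset.range A, C (p i j) * X ^ (r * i + c j)) :
    M0 + S + 2 ≤ k * (A + 1) := by
  classical
  have j0 : Fin k := ⟨0, hk⟩
  have hA : 0 < A := by
    obtain ⟨i, hi, _⟩ := hp j0; omega
  let G : Matrix (Fin k) (Fin k) ℝ[X] := Matrix.of fun s j =>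
    ∑ i ∈ Finset.range A, C (p i j * ((r * i + c j : ℕ) : ℝ) ^ (s : ℕ)) * X ^ (r * i + c j)
  let N : Matrix (Fin k) (Fin k) ℝ[X] := Matrix.of fun s j =>
    ∑ i ∈ Finset.range A, C (p i j * ((r * i + c j : ℕ) : ℝ) ^ (s : ℕ)) * X ^ i
  have hGN : G.det = expand ℝ r N.det * X ^ (∑ j, c j) := by
    have : G = Matrix.of fun s j => X ^ (c j) * (N.map (expand ℝ r)) s j := by
      ext1 s j
      change (∑ i ∈ Finset.range A, _ : ℝ[X]) = X ^ c j * expand ℝ r (∑ i ∈ Finset.range A, _)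
      simp only [map_sum, map_mul, expand_C, map_pow, expand_X, Finset.mul_sum]
      refine Finset.sum_congr rfl fun i _ => ?_
      rw [pow_add, pow_mul]; ring
    rw [this, Matrix.det_mul_row, AlgHom.map_det, Finset.prod_pow_eq_pow_sum, mul_comm]
    rfl
  -- divisibility
  have hdiv : ∀ (ϑ : ℝ) (m : ℕ) (v : Fin k → ℝ), (∀ j, v j ≠ 0) → 
      ((X - C ϑ) ^ m ∣ ∑ j, C (v j) * ∑ i ∈ Finset.range A, C (p i j) * X ^ (r * i + c j)) →
      (X - C ϑ) ^ (m - (k - 1)) ∣ G.det := by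
    intro ϑ m v hv h
    refine det_dvd_of_col G v j0 (hv j0) _ fun s => ?_
    have e1 : (∑ j, C (v j) * ∑ i ∈ Finset.range A, C (p i j) * X ^ (r * i + c j))
        = ∑ z ∈ Finset.univ ×ˢ Finset.range A, C (v z.1 * p z.2 z.1) * X ^ (r * z.2 + c z.1) := by
      rw [Finset.sum_product]
      refine Finset.sum_congr rfl fun j _ => ?_
      rw [Finset.mul_sum]
      refine Finset.sum_congr rfl fun i _ => ?_
      rw [C_mul]; ring
    rw [e1] at h
    have h3 := dlt_iter_dvd ϑ m _ h s
    rw [dlt_iter_sum] at h3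
    have e2 : ∑ j, C (v j) * G s j = ∑ z ∈ Finset.univ ×ˢ Finset.range A,
        C (v z.1 * p z.2 z.1 * ((r * z.2 + c z.1 : ℕ) : ℝ) ^ (s : ℕ)) * X ^ (r * z.2 + c z.1) := by
      rw [Finset.sum_product]
      refine Finset.sum_congr rfl fun j _ => ?_
      change C (v j) * (∑ i ∈ Finset.range A, _) = _
      rw [Finset.mul_sum]
      refine Finset.sum_congr rfl fun i _ => ?_
      simp only [C_mul]; ring
    rw [e2]
    refine (pow_dvd_pow _ ?_).trans h3
    have := s.2
    omega
  -- nonvanishing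
  have hV : N.det ≠ 0 := by
    have hex : ∀ j, ∃ i, p i j ≠ 0 := fun j => by
      obtain ⟨i, _, h⟩ := hp j; exact ⟨i, h⟩
    let e : Fin k → ℕ := fun j => Nat.find (hex j)
    have he : ∀ j, p (e j) j ≠ 0 := fun j => Nat.find_spec (hex j)
    have hemin : ∀ j i, i < e j → p i j = 0 := fun j i hi => by
      by_contra h; exact Nat.find_min (hex j) hi h
    have heA : ∀ j, e j < A := fun j => by
      obtain ⟨i, hi, h⟩ := hp j
      exact (Nat.find_min' (hex j) h).trans_lt hi
    let N' : Matrix (Fin k) (Fin k) ℝ[X] := Matrix.of fun s j =>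
      ∑ i ∈ Finset.range A, C (p i j * ((r * i + c j : ℕ) : ℝ) ^ (s : ℕ)) * X ^ (i - e j)
    have hN : N = Matrix.of fun s j => X ^ (e j) * N' s j := by
      ext1 s j
      change (∑ i ∈ Finset.range A, _ : ℝ[X]) = X ^ e j * (∑ i ∈ Finset.range A, _)
      rw [Finset.mul_sum]
      refine Finset.sum_congr rfl fun i _ => ?_
      by_cases hi : i < e j
      · simp [hemin j i hi]
      · rw [mul_left_comm, ← pow_add]; congr 2; omega
    rw [hN, Matrix.det_mul_row]
    refine mul_ne_zero (Finset.prod_ne_zero_iff.2 fun j _ => pow_ne_zero _ X_ne_zero) ?_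
    intro h0
    have h3 : (evalRingHom (0 : ℝ)) N'.det = 0 := by rw [h0]; simp
    rw [RingHom.map_det] at h3
    have h4 : (evalRingHom (0 : ℝ)).mapMatrix N' = Matrix.of fun s j => p (e j) j *
        (Matrix.vandermonde (fun j => ((r * e j + c j : ℕ) : ℝ))).transpose s j := by
      ext s j
      change eval 0 (∑ i ∈ Finset.range A, _ : ℝ[X]) = _
      simp only [Matrix.of_apply, eval_finsetSum, eval_mul, eval_C, eval_pow, eval_X, Matrix.transpose_apply,
        Matrix.vandermonde_apply]
      rw [Finset.sum_eq_single (e j)]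
      · simp
      · intro i _ hi
        rcases lt_or_gt_of_ne hi with h | h
        · simp [hemin j i h]
        · rw [zero_pow (by omega)]; simp
      · intro h; exact absurd (Finset.mem_range.2 (heA j)) h
    rw [h4, Matrix.det_mul_row, Matrix.det_transpose] at h3
    rcases mul_eq_zero.1 h3 with h | h
    · exact (Finset.prod_ne_zero_iff.2 fun j _ => he j) h
    · refine Matrix.det_vandermonde_ne_zero_iff.2 ?_ h
      intro j j' hjj
      have h5 : r * e j + c j = r * e j' + c j' := by
        have h6 : ((r * e j + c j : ℕ) : ℝ) = ((r * e j' + c j' : ℕ) : ℝ) := hjj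
        exact_mod_cast h6
      apply hc
      have := congrArg (· % r) h5
      simpa [Nat.add_mod, Nat.mod_eq_of_lt (hcr _)] using this
  have hd1 := transfer 1 one_ne_zero r hr _ hV _ _
    (hGN ▸ hdiv 1 M0 (fun _ => 1) (fun _ => one_ne_zero) (by simpa using h1))
  have hd2 := transfer θ hθ r hr _ hV _ _ (hGN ▸ hdiv θ S u hu h2)
  rw [one_pow] at hd1
  have hcop : IsCoprime ((X - C (1:ℝ)) ^ (M0 - (k - 1))) ((X - C (θ ^ r)) ^ (S - (k - 1))) := by
    apply IsCoprime.pow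
    apply isCoprime_X_sub_C_of_isUnit_sub
    rw [isUnit_iff_ne_zero, sub_ne_zero]
    exact hθ1.symm
  have hdd := natDegree_le_of_dvd (hcop.mul_dvd hd1 hd2) hV
  rw [((monic_X_sub_C _).pow _).natDegree_mul ((monic_X_sub_C _).pow _),
    natDegree_pow, natDegree_pow, natDegree_X_sub_C, natDegree_X_sub_C] at hdd
  have hND : N.det.natDegree ≤ k * (A - 1) := by
    apply natDegree_det_le'
    intro s j
    change (∑ i ∈ Finset.range A, _ : ℝ[X]).natDegree ≤ _
    apply natDegree_sum_le_of_forall_le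
    intro i hi
    refine (natDegree_C_mul_X_pow_le _ _).trans ?_
    have := Finset.mem_range.1 hi
    omega
  obtain ⟨A, rfl⟩ : ∃ A', A = A' + 1 := ⟨A - 1, by omega⟩
  simp only [Nat.add_sub_cancel] at hND
  have : k * (A + 1 + 1) = k * A + k + k := by ring
  omega
end PadTS

namespace PadTS
open Polynomial

lemma pow_dvd_of_hasse {ι : Type*} (t : Finset ι) (a : ι → ℝ) (w : ι → ℕ) (θ : ℝ) (hθ : θ ≠ 0)
    (S : ℕ) (h : ∀ σ < S, ∑ z ∈ t, a z * ((w z).choose σ : ℝ) * θ ^ (w z) = 0) :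
    (X - C θ) ^ S ∣ ∑ z ∈ t, C (a z) * X ^ (w z) := by
  rw [X_sub_C_pow_dvd_iff, X_pow_dvd_iff]
  intro σ hσ
  change (taylor θ _).coeff σ = 0
  rw [taylor_coeff, map_sum, eval_finsetSum]
  have h1 : θ ^ σ * ∑ i ∈ t, eval θ ((hasseDeriv σ) (C (a i) * X ^ w i)) = 0 := by
    rw [Finset.mul_sum, ← h σ hσ]
    refine Finset.sum_congr rfl fun z _ => ?_
    rw [C_mul_X_pow_eq_monomial, hasseDeriv_monomial, eval_monomial]
    by_cases hw : σ ≤ w z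
    · have : θ ^ (w z) = θ ^ (w z - σ) * θ ^ σ := by rw [← pow_add]; congr 1; omega
      rw [this]; ring
    · rw [Nat.choose_eq_zero_of_lt (by omega)]; simp
  exact (mul_eq_zero.1 h1).resolve_left (pow_ne_zero _ hθ)

theorem zero_est (A B r M0 S : ℕ) (hr : 0 < r) (hBr : B ≤ r) (p : ℕ → ℕ → ℝ)
    (hp : ∃ i < A, ∃ j < B, p i j ≠ 0)
    (h0 : ∀ τ < M0, ∑ i ∈ Finset.range A, ∑ j ∈ Finset.range B,
      p i j * ((r * i + j).choose τ : ℝ) = 0)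
    (x ζ θ : ℝ) (hθ : θ ≠ 0) (hx : θ ^ r = x) (hx1 : x ≠ 1) (hζ : ζ ≠ 0)
    (hM : B ≤ M0) (hS : B ≤ S) (hMS : B * (A + 1) ≤ M0 + S) :
    ∃ σ < S, ∑ i ∈ Finset.range A, ∑ j ∈ Finset.range B,
      p i j * ((r * i + j).choose σ : ℝ) * x ^ i * ζ ^ j ≠ 0 := by
  classical
  by_contra hcon
  push Not at hcon
  let J := (Finset.range B).filter fun j => ∃ i < A, p i j ≠ 0
  let c : Fin J.card → ℕ := fun j => J.orderEmbOfFin rfl j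
  have hcJ : ∀ j, c j ∈ J := fun j => J.orderEmbOfFin_mem rfl j
  have hcinj : Function.Injective c := (J.orderEmbOfFin rfl).injective
  have hcB : ∀ j, c j < B := fun j => Finset.mem_range.1 (Finset.mem_filter.1 (hcJ j)).1
  have hJB : J.card ≤ B := (Finset.card_filter_le _ _).trans (by simp)
  have hsum : ∀ (g : ℕ → ℝ), (∀ j < B, (∀ i < A, p i j = 0) → g j = 0) →
      ∑ j, g (c j) = ∑ j ∈ Finset.range B, g j := by
    intro g hg
    have h1 : Finset.univ.image c = J := by
      apply Finset.eq_of_subset_of_card_le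
      · intro y hy
        obtain ⟨j, _, rfl⟩ := Finset.mem_image.1 hy
        exact hcJ j
      · rw [Finset.card_image_of_injective _ hcinj]; simp
    have h2 : ∑ j ∈ J, g j = ∑ j ∈ Finset.range B, g j := by
      apply Finset.sum_subset (Finset.filter_subset _ _)
      intro j hj hjJ
      apply hg j (Finset.mem_range.1 hj)
      intro i hi
      by_contra hne
      exact hjJ (Finset.mem_filter.2 ⟨hj, i, hi, hne⟩)
    rw [← h2]
    have h3 := Finset.sum_image (f := g) (s := Finset.univ) (g := c) (fun a _ b _ h => hcinj h)
    rw [h1] at h3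
    exact h3.symm
  have hk : 0 < J.card := by
    obtain ⟨i, hi, j, hj, hne⟩ := hp
    exact Finset.card_pos.2 ⟨j, Finset.mem_filter.2 ⟨Finset.mem_range.2 hj, i, hi, hne⟩⟩
  have key := zero_core J.card A r M0 S hr c hcinj (fun j => (hcB j).trans_le hBr)
    (fun i j => p i (c j)) (fun j => (Finset.mem_filter.1 (hcJ j)).2) hk θ hθ (hx ▸ hx1)
    (fun j => (ζ / θ) ^ (c j)) (fun j => pow_ne_zero _ (div_ne_zero hζ hθ))
    (hJB.trans hM) (hJB.trans hS) ?_ ?_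
  · have : J.card * (A + 1) ≤ B * (A + 1) := Nat.mul_le_mul_right _ hJB
    omega
  · have := pow_dvd_of_hasse (Finset.univ ×ˢ Finset.range A : Finset (Fin J.card × ℕ))
      (fun z => p z.2 (c z.1)) (fun z => r * z.2 + c z.1) 1 one_ne_zero M0 ?_
    · rwa [Finset.sum_product] at this
    · intro σ hσ
      rw [Finset.sum_product, ← h0 σ hσ, Finset.sum_comm (s := Finset.range A)]
      rw [hsum (fun j => ∑ y ∈ Finset.range A, p y j * ((r * y + j).choose σ : ℝ) * 1 ^ (r * y + j))]
      · simp
      · intro j _ hz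
        refine Finset.sum_eq_zero fun i hi => ?_
        rw [hz i (Finset.mem_range.1 hi)]; simp
  · have := pow_dvd_of_hasse (Finset.univ ×ˢ Finset.range A : Finset (Fin J.card × ℕ))
      (fun z => (ζ / θ) ^ (c z.1) * p z.2 (c z.1)) (fun z => r * z.2 + c z.1) θ hθ S ?_
    · rw [Finset.sum_product] at this
      convert this using 2 with j
      rw [Finset.mul_sum]
      refine Finset.sum_congr rfl fun i _ => ?_
      rw [C_mul]; ring
    · intro σ hσ
      rw [Finset.sum_product, ← hcon σ hσ, Finset.sum_comm (s := Finset.range A)]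
      rw [hsum (fun j => ∑ y ∈ Finset.range A,
        (ζ / θ) ^ j * p y j * ((r * y + j).choose σ : ℝ) * θ ^ (r * y + j))]
      · refine Finset.sum_congr rfl fun j _ => Finset.sum_congr rfl fun i _ => ?_
        rw [pow_add, pow_mul, hx, div_pow]
        field_simp
      · intro j _ hz
        refine Finset.sum_eq_zero fun i hi => ?_
        rw [hz i (Finset.mem_range.1 hi)]; simp
end PadTS

namespace PadTS
open Polynomial

/-- The real root and a complex root of `x ^ 3 = x + 1`. -/
structure Roots (α : ℝ) (β : ℂ) : Prop where
  lo : 1.3247 < α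
  hi : α < 1.3248
  cube : α ^ 3 = α + 1
  sum : β + (starRingEnd ℂ) β = -(α : ℂ)
  mul : (α : ℂ) * (β * (starRingEnd ℂ) β) = 1
  im : β.im ≠ 0

lemma exists_roots : ∃ (α : ℝ) (β : ℂ), Roots α β := by
  have hcont : ContinuousOn (fun x : ℝ => x ^ 3 - x - 1) (Set.Icc 1.3247 1.3248) := by fun_prop
  have h := intermediate_value_Ioo (by norm_num : (1.3247 : ℝ) ≤ 1.3248) hcont
  obtain ⟨α, ⟨h1, h2⟩, h3⟩ := h (show (0 : ℝ) ∈ Set.Ioo _ _ by constructor <;> norm_num)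
  have h3' : α ^ 3 = α + 1 := by simp only at h3; linarith
  have hpos : 0 < α := by linarith
  have hinv : α * α⁻¹ = 1 := mul_inv_cancel₀ hpos.ne'
  have hi1 : 0.75 < α⁻¹ := by
    rw [lt_inv_comm₀ (by norm_num) hpos]; norm_num; linarith
  have hd : 0 < α⁻¹ - α ^ 2 / 4 := by nlinarith
  refine ⟨α, ⟨-α / 2, Real.sqrt (α⁻¹ - α ^ 2 / 4)⟩, h1, h2, h3', ?_, ?_, ?_⟩
  · apply Complex.ext <;> simp
  · rw [Complex.mul_conj, Complex.normSq_mk, Real.mul_self_sqrt hd.le, ← Complex.ofReal_mul,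
      ← Complex.ofReal_one]
    congr 1
    nlinarith
  · exact (Real.sqrt_pos.2 hd).ne'

variable {α : ℝ} {β : ℂ}

lemma Roots.pos (h : Roots α β) : 0 < α := by linarith [h.lo]

lemma Roots.normSq (h : Roots α β) : α * ‖β‖ ^ 2 = 1 := by
  have := h.mul
  rw [Complex.mul_conj, Complex.normSq_eq_norm_sq, ← Complex.ofReal_mul] at this
  exact_mod_cast this

lemma Roots.norm_le (h : Roots α β) : ‖β‖ ≤ 1 := by
  have := h.normSq
  have h1 := h.lo
  by_contra hlt
  push Not at hlt
  nlinarith [norm_nonneg β]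

lemma Roots.betaSq (h : Roots α β) : β ^ 2 = -(α : ℂ) * β - (α : ℂ)⁻¹ := by
  have h1 := h.sum
  have h2 := h.mul
  have h0 : (α : ℂ) ≠ 0 := by exact_mod_cast h.pos.ne'
  have h3 : β * (starRingEnd ℂ) β = (α : ℂ)⁻¹ := by field_simp; linear_combination h2
  linear_combination β * h1 - h3

lemma Roots.betaCube (h : Roots α β) : β ^ 3 = β + 1 := by
  have h0 : (α : ℂ) ≠ 0 := by exact_mod_cast h.pos.ne'
  have hc : (α : ℂ) ^ 3 = α + 1 := by exact_mod_cast h.cube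
  have h2 := h.betaSq
  have h4 : (α : ℂ) * β ^ 2 = -(α : ℂ) ^ 2 * β - 1 := by rw [h2]; field_simp
  have : (α : ℂ) * β ^ 3 = α * (β + 1) := by
    linear_combination (β - α) * h4 + β * hc
  exact mul_left_cancel₀ h0 this

lemma Roots.irrat (h : Roots α β) (b c : ℤ) (hbc : (b : ℝ) = c * α) : c = 0 := by
  by_contra hc
  have hcR : (c : ℝ) ≠ 0 := by exact_mod_cast hc
  have hq : (((b : ℚ) / c : ℚ) : ℝ) = α := by
    push_cast; rw [hbc]; field_simp
  have hroot : aeval ((b : ℚ) / c) (X ^ 3 - X - 1 : ℤ[X]) = 0 := by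
    simp only [map_sub, map_pow, aeval_X, map_one]
    have : ((((b : ℚ) / c) ^ 3 - (b : ℚ) / c - 1 : ℚ) : ℝ) = 0 := by
      push_cast at hq ⊢; rw [hq, h.cube]; ring
    exact_mod_cast this
  have hm : (X ^ 3 - X - 1 : ℤ[X]).Monic := by monicity!
  obtain ⟨z, hz⟩ := isInteger_of_is_root_of_monic hm hroot
  rw [← hz] at hq
  have h1 := h.lo
  have h2 := h.hi
  simp only [algebraMap_int_eq, eq_intCast, Rat.cast_intCast] at hq
  rw [← hq] at h1 h2
  have : (1 : ℤ) < z := by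
    have : (1 : ℝ) < z := by linarith
    exact_mod_cast this
  have : z < 2 := by
    have : (z : ℝ) < 2 := by linarith
    exact_mod_cast this
  omega

lemma Roots.norm_ge (h : Roots α β) (f : ℤ[X]) (hf : aeval α f ≠ 0) :
    1 ≤ |aeval α f| * ‖aeval β f‖ ^ 2 := by
  have hm : (X ^ 3 - X - 1 : ℤ[X]).Monic := by monicity!
  have hdeg : (X ^ 3 - X - 1 : ℤ[X]).natDegree = 3 := by compute_degree!
  set g := f %ₘ (X ^ 3 - X - 1) with hg
  have hgd : g.natDegree < 3 := hdeg ▸ natDegree_modByMonic_lt f hm (by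
    intro h1; rw [h1] at hdeg; simp at hdeg)
  have hfg : f = g + (X ^ 3 - X - 1) * (f /ₘ (X ^ 3 - X - 1)) := (modByMonic_add_div f _).symm
  set a := g.coeff 0
  set b := g.coeff 1
  set c := g.coeff 2
  have hgs : g = C a + C b * X + C c * X ^ 2 := by
    conv_lhs => rw [g.as_sum_range' 3 hgd]
    simp only [Finset.sum_range_succ, Finset.sum_range_zero, ← C_mul_X_pow_eq_monomial]
    simp [a, b, c]
  have hα : aeval α f = a + b * α + c * α ^ 2 := by
    rw [hfg, map_add, map_mul]
    have : aeval α (X ^ 3 - X - 1 : ℤ[X]) = 0 := by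
      simp only [map_sub, map_pow, aeval_X, map_one]; rw [h.cube]; ring
    rw [this, hgs]; simp
  have hβ : aeval β f = a + b * β + c * β ^ 2 := by
    rw [hfg, map_add, map_mul]
    have : aeval β (X ^ 3 - X - 1 : ℤ[X]) = 0 := by
      simp only [map_sub, map_pow, aeval_X, map_one]; rw [h.betaCube]; ring
    rw [this, hgs]; simp
  have h0 : (α : ℂ) ≠ 0 := by exact_mod_cast h.pos.ne'
  have hns : ((‖aeval β f‖ ^ 2 : ℝ) : ℂ) =
      a ^ 2 + b ^ 2 * (α : ℂ)⁻¹ + c ^ 2 * ((α : ℂ)⁻¹) ^ 2 - a * b * α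
        + a * c * (α ^ 2 - 2 * (α : ℂ)⁻¹) - b * c * (α : ℂ)⁻¹ * α := by
    rw [← Complex.normSq_eq_norm_sq, ← Complex.mul_conj, hβ]
    have h3 : β * (starRingEnd ℂ) β = (α : ℂ)⁻¹ := by
      have := h.mul; field_simp; linear_combination this
    have h4 := h.sum
    simp only [map_add, map_mul, map_pow, map_intCast]
    set γ := (starRingEnd ℂ) β
    have h5 : γ = -α - β := by linear_combination h4
    linear_combination (b ^ 2 + c ^ 2 * (β * γ + (α : ℂ)⁻¹) + b * c * (β + γ) - 2 * a * c) * h3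
      + (a * b + a * c * (β + γ - α) + b * c * (α : ℂ)⁻¹) * h4
  have hns' : ‖aeval β f‖ ^ 2 = a ^ 2 + b ^ 2 * α⁻¹ + c ^ 2 * α⁻¹ ^ 2 - a * b * α
        + a * c * (α ^ 2 - 2 * α⁻¹) - b * c * α⁻¹ * α := by
    exact_mod_cast hns
  have hinv : α⁻¹ = α ^ 2 - 1 := by
    have := h.cube
    have h6 := h.pos
    field_simp
    linarith
  let N : ℤ := a ^ 3 + b ^ 3 + c ^ 3 + 2 * a ^ 2 * c - a * b ^ 2 + a * c ^ 2 - b * c ^ 2 - 3 * a * b * c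
  have hN : aeval α f * ‖aeval β f‖ ^ 2 = N := by
    rw [hns', hα, hinv]
    simp only [N]
    push_cast
    have hc := h.cube
    have h4 : α ^ 4 = α ^ 2 + α := by linear_combination α * hc
    have h5 : α ^ 5 = α ^ 2 + α + 1 := by linear_combination α * h4 + hc
    have h6 : α ^ 6 = α ^ 2 + 2 * α + 1 := by linear_combination α * h5 + hc
    ring_nf
    rw [h6, h4, hc]
    ring
  have hβ0 : aeval β f ≠ 0 := by
    intro hz
    rw [hβ, h.betaSq] at hz
    have e1 : ((b : ℂ) - c * α) * β + (a - c * (α : ℂ)⁻¹) = 0 := by linear_combination hz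
    have e2 := congrArg Complex.im e1
    have e3 : ((b : ℝ) - c * α) * β.im = 0 := by
      have : (((b : ℂ) - c * α) * β + (a - c * (α : ℂ)⁻¹)).im = ((b : ℝ) - c * α) * β.im := by
        have q1 : ((b : ℂ) - c * α) = (((b : ℝ) - c * α : ℝ) : ℂ) := by push_cast; rfl
        have q2 : ((a : ℂ) - c * (α : ℂ)⁻¹) = (((a : ℝ) - c * α⁻¹ : ℝ) : ℂ) := by push_cast; rfl
        rw [q1, q2, Complex.add_im, Complex.im_ofReal_mul, Complex.ofReal_im, add_zero]
      rw [← this, e2]; rfl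
    have e4 : (b : ℝ) = c * α := by
      have := (mul_eq_zero.1 e3).resolve_right h.im
      linarith
    have hc0 := h.irrat b c e4
    have hb0 : b = 0 := by
      rw [hc0] at e4; simp at e4; exact_mod_cast e4
    rw [hc0, hb0] at e1
    have ha0 : a = 0 := by simpa using e1
    apply hf
    rw [hα, ha0, hb0, hc0]; simp
  have hN0 : N ≠ 0 := by
    intro hz
    rw [hz] at hN
    have : ‖aeval β f‖ ^ 2 ≠ 0 := pow_ne_zero _ (norm_ne_zero_iff.2 hβ0)
    rcases mul_eq_zero.1 (by simpa using hN : aeval α f * ‖aeval β f‖ ^ 2 = 0) with h | h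
    · exact hf h
    · exact this h
  have h1 : (1 : ℝ) ≤ |(N : ℝ)| := by exact_mod_cast Int.one_le_abs hN0
  rw [← hN, abs_mul, abs_of_nonneg (sq_nonneg ‖aeval β f‖)] at h1
  exact h1
end PadTS

namespace PadTS

attribute [local instance] Matrix.seminormedAddCommGroup

lemma siegel_aux (A' B r : ℕ) (hA : 0 < A') (hB : 0 < B) (hBr : B ≤ r) :
    ∃ p : ℕ → ℕ → ℤ, (∃ i < 4 * A', ∃ j < B, p i j ≠ 0) ∧
      (∀ τ < 3 * A' * B, ∑ i ∈ Finset.range (4 * A'), ∑ j ∈ Finset.range B,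
        p i j * ((r * i + j).choose τ : ℤ) = 0) ∧
      ∀ i j, (|p i j| : ℤ) ≤ ((4 * A' * B) * 2 ^ (r * (4 * A'))) ^ 3 := by
  let Mx : Matrix (Fin (3 * A' * B)) (Fin (4 * A') × Fin B) ℤ :=
    Matrix.of fun τ z => ((r * z.1 + z.2).choose τ : ℤ)
  have hAB : 0 < A' * B := Nat.mul_pos hA hB
  have e1 : 3 * A' * B = 3 * (A' * B) := by ring
  have e2 : 4 * A' * B = 4 * (A' * B) := by ring
  obtain ⟨t, ht0, ht1, ht2⟩ := Int.Matrix.exists_ne_zero_int_vec_norm_le Mx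
    (by simp only [Fintype.card_fin, Fintype.card_prod]; omega)
    (by simp only [Fintype.card_fin]; omega)
  have hMx : max 1 ‖Mx‖ ≤ 2 ^ (r * (4 * A')) := by
    apply max_le
    · exact one_le_pow₀ (by norm_num)
    · rw [Matrix.norm_le_iff (by positivity)]
      intro τ z
      change ‖(((r * z.1 + z.2).choose τ : ℕ) : ℤ)‖ ≤ _
      rw [Int.norm_natCast]
      have h1 : (r * z.1 + z.2).choose τ ≤ 2 ^ (r * z.1 + z.2 : ℕ) := Nat.choose_le_two_pow _ _
      have h2 : 2 ^ (r * z.1 + z.2 : ℕ) ≤ 2 ^ (r * (4 * A')) := by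
        apply Nat.pow_le_pow_right (by norm_num)
        have a1 := z.1.2
        have a2 := z.2.2
        have : r * z.1 + r ≤ r * (4 * A') := by
          rw [← Nat.mul_succ]; exact Nat.mul_le_mul_left _ a1
        omega
      exact_mod_cast h1.trans h2
  have hexp : ((Fintype.card (Fin (3 * A' * B)) : ℝ) /
      ((Fintype.card (Fin (4 * A') × Fin B) : ℝ) - Fintype.card (Fin (3 * A' * B)))) = (3 : ℕ) := by
    simp only [Fintype.card_fin, Fintype.card_prod]
    rw [e1, e2]
    push_cast
    have : ((A' : ℝ) * B) ≠ 0 := by exact_mod_cast hAB.ne'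
    have h3 : (4 : ℝ) * (A' * B) - 3 * (A' * B) = A' * B := by ring
    rw [h3]; field_simp
  rw [hexp, Real.rpow_natCast] at ht2
  have hbd : ∀ z, (|t z| : ℤ) ≤ ((4 * A' * B) * 2 ^ (r * (4 * A'))) ^ 3 := by
    intro z
    have h1 : ‖t z‖ ≤ _ := (norm_le_pi_norm t z).trans ht2
    have h2 : ((Fintype.card (Fin (4 * A') × Fin B) : ℝ) * max 1 ‖Mx‖) ^ 3 ≤
        ((4 * A' * B) * 2 ^ (r * (4 * A'))) ^ 3 := by
      simp only [Fintype.card_fin, Fintype.card_prod]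
      push_cast
      gcongr
    have h3 := h1.trans h2
    rw [Int.norm_eq_abs] at h3
    exact_mod_cast h3
  refine ⟨fun i j => if h : i < 4 * A' ∧ j < B then t (⟨i, h.1⟩, ⟨j, h.2⟩) else 0, ?_, ?_, ?_⟩
  · obtain ⟨z, hz⟩ := Function.ne_iff.1 ht0
    refine ⟨z.1, z.1.2, z.2, z.2.2, ?_⟩
    simpa using hz
  · intro τ hτ
    have h1 := congrFun ht1 ⟨τ, hτ⟩
    simp only [Matrix.mulVec, dotProduct, Fintype.sum_prod_type, Pi.zero_apply] at h1
    refine Eq.trans ?_ h1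
    beta_reduce
    rw [← Fin.sum_univ_eq_sum_range
      (fun i => ∑ j ∈ Finset.range B, (if h : i < 4 * A' ∧ j < B then t (⟨i, h.1⟩, ⟨j, h.2⟩) else 0)
        * ((r * i + j).choose τ : ℤ))]
    refine Finset.sum_congr rfl fun i _ => ?_
    rw [← Fin.sum_univ_eq_sum_range
      (fun j => (if h : (i : ℕ) < 4 * A' ∧ j < B then t (⟨i, h.1⟩, ⟨j, h.2⟩) else 0)
        * ((r * i + j).choose τ : ℤ))]
    refine Finset.sum_congr rfl fun j _ => ?_
    rw [dif_pos ⟨i.2, j.2⟩, mul_comm]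
    rfl
  · intro i j
    beta_reduce
    split_ifs with h
    · exact hbd _
    · rw [abs_zero]; positivity
end PadTS

namespace PadTS
open Polynomial

lemma choose_pow_expand (w W σ : ℕ) (hw : w < W) (θ : ℝ) :
    (w.choose σ : ℝ) * θ ^ w = θ ^ σ * ∑ k ∈ Finset.range W,
      (w.choose k : ℝ) * (k.choose σ : ℝ) * (θ - 1) ^ (k - σ) := by
  by_cases hσ : σ ≤ w
  · have h1 : θ ^ w = θ ^ σ * θ ^ (w - σ) := by rw [← pow_add]; congr 1; omega
    have h2 : θ ^ (w - σ) = ∑ m ∈ Finset.range (w - σ + 1), (θ - 1) ^ m * ((w - σ).choose m : ℝ) := by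
      have := add_pow (θ - 1) 1 (w - σ)
      simpa using this
    have h3 : ∑ k ∈ Finset.range W, (w.choose k : ℝ) * (k.choose σ : ℝ) * (θ - 1) ^ (k - σ)
        = ∑ m ∈ Finset.range (w - σ + 1), (w.choose (σ + m) : ℝ) * ((σ + m).choose σ : ℝ)
          * (θ - 1) ^ m := by
      have e1 : ∑ m ∈ Finset.range (w - σ + 1), (w.choose (σ + m) : ℝ) * ((σ + m).choose σ : ℝ)
          * (θ - 1) ^ m = ∑ k ∈ Finset.Ico σ (w + 1), (w.choose k : ℝ) * (k.choose σ : ℝ)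
            * (θ - 1) ^ (k - σ) := by
        rw [Finset.sum_Ico_eq_sum_range, show w + 1 - σ = w - σ + 1 by omega]
        simp
      rw [e1]
      symm
      apply Finset.sum_subset
      · intro k hk
        simp only [Finset.mem_Ico, Finset.mem_range] at *; omega
      · intro k _ hk
        simp only [Finset.mem_Ico, not_and_or, not_le, not_lt] at hk
        rcases hk with hk | hk
        · rw [Nat.choose_eq_zero_of_lt hk]; simp
        · rw [Nat.choose_eq_zero_of_lt (show w < k by omega)]; simp
    rw [h1, h3, h2, mul_left_comm]
    congr 1
    rw [Finset.mul_sum]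
    refine Finset.sum_congr rfl fun m hm => ?_
    have hm' := Finset.mem_range.1 hm
    have h4 := Nat.choose_mul (n := w) (k := σ + m) (s := σ) (by omega)
    rw [Nat.add_sub_cancel_left] at h4
    have h5 : (w.choose (σ + m) : ℝ) * ((σ + m).choose σ : ℝ) = (w.choose σ : ℝ) * ((w - σ).choose m : ℝ) := by
      exact_mod_cast h4
    rw [h5]; ring
  · rw [Nat.choose_eq_zero_of_lt (by omega)]
    rw [Finset.sum_eq_zero]
    · simp
    · intro k _
      by_cases hk : k < σ
      · rw [Nat.choose_eq_zero_of_lt hk]; simp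
      · rw [Nat.choose_eq_zero_of_lt (show w < k by omega)]; simp

lemma near_pow (t : ℝ) (ht : 0 < t) (r j : ℕ) (hj : j ≤ r) (ε : ℝ) (h : |t ^ r - 1| ≤ ε) :
    |t ^ j - 1| ≤ ε := by
  rw [abs_le] at h ⊢
  rcases le_total 1 t with h1 | h1
  · have h2 := pow_le_pow_right₀ h1 hj
    have h3 := one_le_pow₀ (n := j) h1
    constructor <;> linarith
  · have h2 := pow_le_pow_of_le_one ht.le h1 hj
    have h3 := pow_le_one₀ (n := j) ht.le h1
    constructor <;> linarith

/-- A double sum bound. -/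
lemma dsum_le (A B : ℕ) (f : ℕ → ℕ → ℝ) (K : ℝ) (h : ∀ i < A, ∀ j < B, |f i j| ≤ K) :
    |∑ i ∈ Finset.range A, ∑ j ∈ Finset.range B, f i j| ≤ A * B * K := by
  refine (Finset.abs_sum_le_sum_abs _ _).trans ?_
  have : ∀ i ∈ Finset.range A, |∑ j ∈ Finset.range B, f i j| ≤ B * K := by
    intro i hi
    refine (Finset.abs_sum_le_sum_abs _ _).trans ?_
    refine (Finset.sum_le_sum fun j hj => h i (Finset.mem_range.1 hi) j (Finset.mem_range.1 hj)).trans ?_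
    simp
  refine (Finset.sum_le_sum this).trans ?_
  simp [mul_assoc]

lemma dsum_norm_le (A B : ℕ) (f : ℕ → ℕ → ℂ) (K : ℝ) (h : ∀ i < A, ∀ j < B, ‖f i j‖ ≤ K) :
    ‖∑ i ∈ Finset.range A, ∑ j ∈ Finset.range B, f i j‖ ≤ A * B * K := by
  refine (norm_sum_le _ _).trans ?_
  have : ∀ i ∈ Finset.range A, ‖∑ j ∈ Finset.range B, f i j‖ ≤ B * K := by
    intro i hi
    refine (norm_sum_le _ _).trans ?_
    refine (Finset.sum_le_sum fun j hj => h i (Finset.mem_range.1 hi) j (Finset.mem_range.1 hj)).trans ?_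
    simp
  refine (Finset.sum_le_sum this).trans ?_
  simp [mul_assoc]

lemma w_lt (r A B i j : ℕ) (hBr : B ≤ r) (hi : i < A) (hj : j < B) : r * i + j < r * A := by
  have : r * i + r ≤ r * A := by rw [← Nat.mul_succ]; exact Nat.mul_le_mul_left _ hi
  omega

lemma choose_le_W (r A B i j k : ℕ) (hBr : B ≤ r) (hi : i < A) (hj : j < B) :
    ((r * i + j).choose k : ℝ) ≤ 2 ^ (r * A) := by
  have h1 := Nat.choose_le_two_pow (r * i + j) k
  have h2 : 2 ^ (r * i + j) ≤ 2 ^ (r * A) :=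
    Nat.pow_le_pow_right (by norm_num) (w_lt r A B i j hBr hi hj).le
  exact_mod_cast h1.trans h2

/-- Upper bound for the values of the auxiliary function. -/
lemma upper (A B r M0 S σ : ℕ) (hBr : B ≤ r) (p : ℕ → ℕ → ℝ) (P : ℝ)
    (hP : ∀ i j, |p i j| ≤ P)
    (h0 : ∀ τ < M0, ∑ i ∈ Finset.range A, ∑ j ∈ Finset.range B,
      p i j * ((r * i + j).choose τ : ℝ) = 0)
    (x ζ θ ρ ε : ℝ) (hθ : 0 < θ) (hx : θ ^ r = x) (hζ : 0 < ζ) (hε : |ζ ^ r / x - 1| ≤ ε)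
    (hρ : |θ - 1| ≤ ρ) (hρ1 : ρ ≤ 1) (hσ : σ < S) (hSM : S ≤ M0) (hσW : S ≤ r * A) :
    |∑ i ∈ Finset.range A, ∑ j ∈ Finset.range B,
      p i j * ((r * i + j).choose σ : ℝ) * x ^ i * ζ ^ j| ≤
      (1 + ρ) ^ (r * A) * (A * B * 2 ^ (r * A)) * P * ((r * A : ℕ) * 2 ^ (r * A) * ρ ^ (M0 - S) + ε) := by
  have hP0 : 0 ≤ P := (abs_nonneg _).trans (hP 0 0)
  have hρ0 : 0 ≤ ρ := (abs_nonneg _).trans hρ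
  have hε0 : 0 ≤ ε := (abs_nonneg _).trans hε
  have hθ1 : θ ≤ 1 + ρ := by have := (abs_le.1 hρ).2; linarith
  have hθW : ∀ w ≤ r * A, θ ^ w ≤ (1 + ρ) ^ (r * A) := by
    intro w hw
    exact (pow_le_pow_left₀ hθ.le hθ1 w).trans (pow_le_pow_right₀ (by linarith) hw)
  have hsplit : ∑ i ∈ Finset.range A, ∑ j ∈ Finset.range B,
      p i j * ((r * i + j).choose σ : ℝ) * x ^ i * ζ ^ j =
      (∑ i ∈ Finset.range A, ∑ j ∈ Finset.range B,
        p i j * ((r * i + j).choose σ : ℝ) * θ ^ (r * i + j) * ((ζ / θ) ^ j - 1)) +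
      ∑ i ∈ Finset.range A, ∑ j ∈ Finset.range B,
        p i j * ((r * i + j).choose σ : ℝ) * θ ^ (r * i + j) := by
    rw [← Finset.sum_add_distrib]
    refine Finset.sum_congr rfl fun i _ => ?_
    rw [← Finset.sum_add_distrib]
    refine Finset.sum_congr rfl fun j _ => ?_
    rw [pow_add, pow_mul, hx, div_pow]
    field_simp
    ring
  have hb1 : |∑ i ∈ Finset.range A, ∑ j ∈ Finset.range B,
        p i j * ((r * i + j).choose σ : ℝ) * θ ^ (r * i + j) * ((ζ / θ) ^ j - 1)| ≤
        A * B * (P * 2 ^ (r * A) * (1 + ρ) ^ (r * A) * ε) := by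
    apply dsum_le
    intro i hi j hj
    rw [abs_mul, abs_mul, abs_mul, Nat.abs_cast, abs_of_pos (pow_pos hθ _)]
    have h1 := hP i j
    have h2 := choose_le_W r A B i j σ hBr hi hj
    have h3 := hθW _ (w_lt r A B i j hBr hi hj).le
    have h4 : |(ζ / θ) ^ j - 1| ≤ ε := by
      apply near_pow _ (div_pos hζ hθ) r j (by omega)
      rwa [div_pow, hx]
    gcongr
  have hexp : ∑ i ∈ Finset.range A, ∑ j ∈ Finset.range B,
        p i j * ((r * i + j).choose σ : ℝ) * θ ^ (r * i + j) =
      θ ^ σ * ∑ k ∈ Finset.range (r * A), (∑ i ∈ Finset.range A, ∑ j ∈ Finset.range B,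
        p i j * ((r * i + j).choose k : ℝ)) * ((k.choose σ : ℝ) * (θ - 1) ^ (k - σ)) := by
    simp only [Finset.sum_mul]
    rw [Finset.sum_comm (s := Finset.range (r * A)), Finset.mul_sum]
    refine Finset.sum_congr rfl fun i hi => ?_
    rw [Finset.sum_comm (s := Finset.range (r * A)), Finset.mul_sum]
    refine Finset.sum_congr rfl fun j hj => ?_
    rw [mul_assoc, choose_pow_expand _ (r * A) σ
      (w_lt r A B i j hBr (Finset.mem_range.1 hi) (Finset.mem_range.1 hj)) θ, mul_left_comm, Finset.mul_sum]
    congr 1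
    refine Finset.sum_congr rfl fun k _ => ?_
    ring
  have hb2 : |∑ i ∈ Finset.range A, ∑ j ∈ Finset.range B,
        p i j * ((r * i + j).choose σ : ℝ) * θ ^ (r * i + j)| ≤
      (1 + ρ) ^ (r * A) * ((r * A : ℕ) * (A * B * (P * 2 ^ (r * A)) * (2 ^ (r * A) * ρ ^ (M0 - S)))) := by
    rw [hexp, abs_mul, abs_of_pos (pow_pos hθ _)]
    apply mul_le_mul (hθW _ (by omega)) _ (abs_nonneg _) (by positivity)
    refine (Finset.abs_sum_le_sum_abs _ _).trans ?_
    have : ∀ k ∈ Finset.range (r * A), |(∑ i ∈ Finset.range A, ∑ j ∈ Finset.range B,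
        p i j * ((r * i + j).choose k : ℝ)) * ((k.choose σ : ℝ) * (θ - 1) ^ (k - σ))| ≤
        A * B * (P * 2 ^ (r * A)) * (2 ^ (r * A) * ρ ^ (M0 - S)) := by
      intro k hk
      have hk' := Finset.mem_range.1 hk
      by_cases hkM : k < M0
      · rw [h0 k hkM]; simp; positivity
      · rw [abs_mul]
        apply mul_le_mul _ _ (abs_nonneg _) (by positivity)
        · apply dsum_le
          intro i hi j hj
          rw [abs_mul, Nat.abs_cast]
          have h1 := hP i j
          have h2 := choose_le_W r A B i j k hBr hi hj
          gcongr
        · rw [abs_mul, Nat.abs_cast, abs_pow]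
          have h1 : (k.choose σ : ℝ) ≤ 2 ^ (r * A) := by
            have h1 := Nat.choose_le_two_pow k σ
            have h2 : 2 ^ k ≤ 2 ^ (r * A) := Nat.pow_le_pow_right (by norm_num) hk'.le
            exact_mod_cast h1.trans h2
          have h2 : |θ - 1| ^ (k - σ) ≤ ρ ^ (M0 - S) :=
            (pow_le_pow_left₀ (abs_nonneg _) hρ _).trans (pow_le_pow_of_le_one hρ0 hρ1 (by omega))
          gcongr
    refine (Finset.sum_le_sum this).trans ?_
    simp
  rw [hsplit]
  refine (abs_add_le _ _).trans ((add_le_add hb1 hb2).trans (le_of_eq ?_))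
  ring
end PadTS

namespace PadTS
open Polynomial
variable {α : ℝ} {β : ℂ}

lemma no_rat (b c : ℤ) (hc : c ≠ 0) (h : b ^ 3 = b * c ^ 2 + c ^ 3) : False := by
  have hcQ : (c : ℚ) ≠ 0 := by exact_mod_cast hc
  have hroot : aeval ((b : ℚ) / c) (X ^ 3 - X - 1 : ℤ[X]) = 0 := by
    simp only [map_sub, map_pow, aeval_X, map_one]
    have : (b : ℚ) ^ 3 = b * c ^ 2 + c ^ 3 := by exact_mod_cast h
    field_simp
    linarith
  have hm : (X ^ 3 - X - 1 : ℤ[X]).Monic := by monicity!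
  obtain ⟨z, hz⟩ := isInteger_of_is_root_of_monic hm hroot
  rw [← hz] at hroot
  simp only [map_sub, map_pow, aeval_X, map_one, algebraMap_int_eq, eq_intCast] at hroot
  have h2 : z ^ 3 - z - 1 = 0 := by exact_mod_cast hroot
  have h3 : Even (z ^ 3 - z) := by
    rcases Int.even_or_odd z with hz | hz <;> simp [hz, parity_simps]
  have h4 : z ^ 3 - z = 1 := by linarith
  rw [h4] at h3
  exact absurd h3 (by decide)

lemma Roots.indep (h : Roots α β) (a b c : ℤ) (hz : (a : ℝ) + b * α + c * α ^ 2 = 0) :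
    a = 0 ∧ b = 0 ∧ c = 0 := by
  by_cases hc : c = 0
  · subst hc
    have h1 : ((-a : ℤ) : ℝ) = b * α := by push_cast; simp at hz; linarith
    have hb := h.irrat _ _ h1
    subst hb
    simp at h1
    exact ⟨by exact_mod_cast h1, rfl, rfl⟩
  · exfalso
    have h1 : ((-(a * b - c ^ 2) : ℤ) : ℝ) = ((b ^ 2 - a * c - c ^ 2 : ℤ) : ℝ) * α := by
      push_cast
      have := h.cube
      linear_combination (c * α - b) * hz - c ^ 2 * this
    have h2 := h.irrat _ _ h1
    have h3 : a * b = c ^ 2 := by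
      rw [h2] at h1
      simp only [Int.cast_zero, zero_mul] at h1
      have h4 : -(a * b - c ^ 2) = 0 := by exact_mod_cast h1
      linarith
    apply no_rat b c hc
    linear_combination b * h2 + c * h3

lemma Roots.conj_zero (h : Roots α β) (f : ℤ[X]) (hf : aeval α f = 0) : aeval β f = 0 := by
  have hm : (X ^ 3 - X - 1 : ℤ[X]).Monic := by monicity!
  have hdeg : (X ^ 3 - X - 1 : ℤ[X]).natDegree = 3 := by compute_degree!
  set g := f %ₘ (X ^ 3 - X - 1) with hg
  have hgd : g.natDegree < 3 := hdeg ▸ natDegree_modByMonic_lt f hm (by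
    intro h1; rw [h1] at hdeg; simp at hdeg)
  have hfg : f = g + (X ^ 3 - X - 1) * (f /ₘ (X ^ 3 - X - 1)) := (modByMonic_add_div f _).symm
  set a := g.coeff 0
  set b := g.coeff 1
  set c := g.coeff 2
  have hgs : g = C a + C b * X + C c * X ^ 2 := by
    conv_lhs => rw [g.as_sum_range' 3 hgd]
    simp only [Finset.sum_range_succ, Finset.sum_range_zero, ← C_mul_X_pow_eq_monomial]
    simp [a, b, c]
  have hα : aeval α f = a + b * α + c * α ^ 2 := by
    rw [hfg, map_add, map_mul]
    have : aeval α (X ^ 3 - X - 1 : ℤ[X]) = 0 := by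
      simp only [map_sub, map_pow, aeval_X, map_one]; rw [h.cube]; ring
    rw [this, hgs]; simp
  have hβ : aeval β f = a + b * β + c * β ^ 2 := by
    rw [hfg, map_add, map_mul]
    have : aeval β (X ^ 3 - X - 1 : ℤ[X]) = 0 := by
      simp only [map_sub, map_pow, aeval_X, map_one]; rw [h.betaCube]; ring
    rw [this, hgs]; simp
  obtain ⟨ha, hb, hc⟩ := h.indep a b c (hα ▸ hf)
  rw [hβ, ha, hb, hc]; simp

lemma Roots.x_ne_one (h : Roots α β) (d a0 n0 : ℕ) (hd : 1 ≤ d) (ha : 2 ≤ a0) :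
    (3 * α ^ 2 - 1) * d * 10 ^ a0 / (9 * α ^ n0) ≠ 1 := by
  intro hx
  have hαp : 0 < 9 * α ^ n0 := by have := h.pos; positivity
  rw [div_eq_one_iff_eq hαp.ne'] at hx
  have h1 : aeval α ((3 * X ^ 2 - 1) * (d : ℤ[X]) * 10 ^ a0 - 9 * X ^ n0 : ℤ[X]) = 0 := by
    have e3 : aeval α (3 : ℤ[X]) = 3 := map_ofNat _ _
    have e9 : aeval α (9 : ℤ[X]) = 9 := map_ofNat _ _
    have e10 : aeval α (10 : ℤ[X]) = 10 := map_ofNat _ _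
    simp only [map_sub, map_mul, map_pow, aeval_X, map_natCast, map_one, e3, e9, e10]
    linarith
  have h2 := h.conj_zero _ h1
  have e3 : aeval β (3 : ℤ[X]) = 3 := map_ofNat _ _
  have e9 : aeval β (9 : ℤ[X]) = 9 := map_ofNat _ _
  have e10 : aeval β (10 : ℤ[X]) = 10 := map_ofNat _ _
  simp only [map_sub, map_mul, map_pow, aeval_X, map_natCast, map_one, e3, e9, e10] at h2
  have h3 : ‖(3 * β ^ 2 - 1)‖ * d * 10 ^ a0 = 9 * ‖β‖ ^ n0 := by
    have := congrArg norm (sub_eq_zero.1 h2)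
    simpa using this
  have h4 : ‖β‖ ^ n0 ≤ 1 := pow_le_one₀ (norm_nonneg _) h.norm_le
  have h5 := h.norm_ge (3 * X ^ 2 - 1) (by
    have e3 : aeval α (3 : ℤ[X]) = 3 := map_ofNat _ _
    simp only [map_sub, map_mul, map_pow, aeval_X, map_one, e3]
    have := h.lo
    nlinarith)
  have e3' : aeval α (3 : ℤ[X]) = 3 := map_ofNat _ _
  simp only [map_sub, map_mul, map_pow, aeval_X, map_one, e3, e3'] at h5
  have h6 : |3 * α ^ 2 - 1| ≤ 5 := by
    have := h.lo
    have := h.hi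
    rw [abs_le]; constructor <;> nlinarith
  set y := ‖(3 * β ^ 2 - 1)‖
  have hy : 0 ≤ y := norm_nonneg _
  have h7 : 1 ≤ 5 * y ^ 2 := h5.trans (by gcongr)
  have h8 : (100 : ℝ) ≤ 10 ^ a0 := by
    calc (100 : ℝ) = 10 ^ 2 := by norm_num
      _ ≤ 10 ^ a0 := pow_le_pow_right₀ (by norm_num) ha
  have h9 : (1 : ℝ) ≤ d := by exact_mod_cast hd
  have h10 : y * 100 ≤ 9 := by
    calc y * 100 ≤ y * d * 10 ^ a0 := by
          apply mul_le_mul _ h8 (by norm_num) (by positivity)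
          nlinarith
      _ ≤ 9 := by rw [h3]; linarith
  nlinarith

lemma Roots.quad_norm (h : Roots α β) : ‖(3 * β ^ 2 - 1)‖ ≤ 4 := by
  refine (norm_sub_le _ _).trans ?_
  have := pow_le_one₀ (n := 2) (norm_nonneg _) h.norm_le
  simp
  linarith

theorem main_ineq (h : Roots α β) (n0 n1 a0 a1 r A' B d : ℕ) (hA : 0 < A') (hB : 0 < B)
    (hBr : B ≤ r) (hd1 : 1 ≤ d) (hd9 : d ≤ 9) (ha0 : 2 ≤ a0) (x ζ θ ρ ε : ℝ)
    (hx : x = (3 * α ^ 2 - 1) * d * 10 ^ a0 / (9 * α ^ n0)) (hζ : ζ = α ^ n1 / 10 ^ a1)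
    (hε : |ζ ^ r / x - 1| ≤ ε) (hθ : 0 < θ) (hθr : θ ^ r = x) (hρ : |θ - 1| ≤ ρ) (hρ1 : ρ ≤ 1) :
    1 ≤ ((4 * A' * B) * 2 ^ (r * (4 * A'))) ^ 12 * (9 * α ^ n0) ^ (4 * A') *
      (36 * 10 ^ a0) ^ (2 * (4 * A')) * 10 ^ (3 * a1 * B) * (1 + ρ) ^ (r * (4 * A')) *
      ((r * (4 * A') : ℕ) * 2 ^ (r * (4 * A')) * ρ ^ (2 * A' * B - B) + ε) := by
  obtain ⟨p, hp0, hp1, hp2⟩ := siegel_aux A' B r hA hB hBr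
  have hα0 := h.pos
  have hα1 : 1 ≤ α := by linarith [h.lo]
  have hρ0 : 0 ≤ ρ := (abs_nonneg _).trans hρ
  have hε0 : 0 ≤ ε := (abs_nonneg _).trans hε
  have hζ0 : 0 < ζ := by rw [hζ]; positivity
  have hx1 : x ≠ 1 := by rw [hx]; exact h.x_ne_one d a0 n0 hd1 ha0
  have hBA : B ≤ A' * B := Nat.le_mul_of_pos_left _ hA
  have hABr : A' * B ≤ r * A' := by rw [mul_comm]; exact Nat.mul_le_mul_right _ hBr
  set A := 4 * A' with hAdef
  have hA0 : 0 < A := by omega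
  have h0R : ∀ τ < 3 * A' * B, ∑ i ∈ Finset.range A, ∑ j ∈ Finset.range B,
      ((p i j : ℤ) : ℝ) * ((r * i + j).choose τ : ℝ) = 0 := fun τ hτ => by exact_mod_cast hp1 τ hτ
  have e3 : 3 * A' * B = 3 * (A' * B) := by ring
  obtain ⟨σ, hσ, hne⟩ := zero_est A B r (3 * A' * B) (A' * B + B) (by omega) hBr
    (fun i j => (p i j : ℝ)) (by
      obtain ⟨i, hi, j, hj, hij⟩ := hp0
      exact ⟨i, hi, j, hj, by exact_mod_cast hij⟩) h0R x ζ θ hθ.ne' hθr hx1 hζ0.ne'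
      (by omega) (by omega) (by
        have : B * (A + 1) = 4 * (A' * B) + B := by rw [hAdef]; ring
        omega)
  have e4 : r * A = 4 * (r * A') := by rw [hAdef]; ring
  set H : ℝ := (4 * A' * B) * 2 ^ (r * A) with hH
  have hH0 : 0 ≤ H := by positivity
  have hpR : ∀ i j, |((p i j : ℤ) : ℝ)| ≤ H ^ 3 := fun i j => by
    have := hp2 i j
    rw [hH]
    exact_mod_cast this
  set Eσ := ∑ i ∈ Finset.range A, ∑ j ∈ Finset.range B,
      ((p i j : ℤ) : ℝ) * ((r * i + j).choose σ : ℝ) * x ^ i * ζ ^ j with hEσ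
  have hup := upper A B r (3 * A' * B) (A' * B + B) σ hBr (fun i j => (p i j : ℝ)) (H ^ 3) hpR h0R
    x ζ θ ρ ε hθ hθr hζ0 hε hρ hρ1 hσ (by omega) (by omega)
  rw [show 3 * A' * B - (A' * B + B) = 2 * A' * B - B by
    have : 2 * A' * B = 2 * (A' * B) := by ring
    omega] at hup
  rw [← hEσ] at hup
  have hAB : (A : ℝ) * B * 2 ^ (r * A) = H := by rw [hH, hAdef]; push_cast; ring
  rw [hAB] at hup
  set Z : ℝ := ((r * A : ℕ) * 2 ^ (r * A) * ρ ^ (2 * A' * B - B) + ε) with hZ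
  have hZ0 : 0 ≤ Z := by positivity
  -- the integer polynomial
  let e : ℤ[X] := ∑ i ∈ Finset.range A, ∑ j ∈ Finset.range B,
    C (p i j * ((r * i + j).choose σ : ℤ)) * ((3 * X ^ 2 - 1) * (d : ℤ[X]) * 10 ^ a0) ^ i *
      (9 * X ^ n0) ^ (A - 1 - i) * X ^ (n1 * j) * 10 ^ (a1 * (B - 1 - j))
  have heα : aeval α e = (9 * α ^ n0) ^ (A - 1) * 10 ^ (a1 * (B - 1)) * Eσ := by
    have e3 : aeval α (3 : ℤ[X]) = 3 := map_ofNat _ _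
    have e9 : aeval α (9 : ℤ[X]) = 9 := map_ofNat _ _
    have e10 : aeval α (10 : ℤ[X]) = 10 := map_ofNat _ _
    simp only [e, map_sum, map_sub, map_mul, map_pow, aeval_X, map_natCast, map_one, e3, e9, e10]
    rw [hEσ, Finset.mul_sum]
    refine Finset.sum_congr rfl fun i hi => ?_
    rw [Finset.mul_sum]
    refine Finset.sum_congr rfl fun j hj => ?_
    have hi' := Finset.mem_range.1 hi
    have hj' := Finset.mem_range.1 hj
    have q1 : (9 * α ^ n0) ^ (A - 1) = (9 * α ^ n0) ^ (A - 1 - i) * (9 * α ^ n0) ^ i := by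
      rw [← pow_add]; congr 1; omega
    have q2 : (10 : ℝ) ^ (a1 * (B - 1)) = 10 ^ (a1 * (B - 1 - j)) * (10 ^ a1) ^ j := by
      rw [← pow_mul, ← pow_add, ← Nat.mul_add]; congr 2; omega
    have q3 : (9 * α ^ n0) ^ i * x ^ i = ((3 * α ^ 2 - 1) * d * 10 ^ a0) ^ i := by
      rw [← mul_pow, hx, mul_div_cancel₀]; positivity
    have q4 : ((10 : ℝ) ^ a1) ^ j * ζ ^ j = α ^ (n1 * j) := by
      rw [← mul_pow, hζ, mul_div_cancel₀ _ (by positivity), pow_mul]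
    rw [q1, q2, ← q3, ← q4]
    simp
    ring
  have heβ : ‖aeval β e‖ ≤ H ^ 4 * (36 * 10 ^ a0) ^ A * 10 ^ (a1 * B) := by
    have e3 : aeval β (3 : ℤ[X]) = 3 := map_ofNat _ _
    have e9 : aeval β (9 : ℤ[X]) = 9 := map_ofNat _ _
    have e10 : aeval β (10 : ℤ[X]) = 10 := map_ofNat _ _
    simp only [e, map_sum, map_sub, map_mul, map_pow, aeval_X, map_natCast, map_one, e3, e9, e10]
    refine (dsum_norm_le A B _ (H ^ 3 * 2 ^ (r * A) * ((36 * 10 ^ a0) ^ A * 10 ^ (a1 * B))) ?_).trans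
      (le_of_eq ?_)
    · intro i hi j hj
      rw [norm_mul, norm_mul, norm_mul, norm_mul]
      have t1 : ‖(aeval β) (C (p i j) : ℤ[X]) * ((r * i + j).choose σ : ℂ)‖ ≤ H ^ 3 * 2 ^ (r * A) := by
        have : (aeval β) (C (p i j) : ℤ[X]) * ((r * i + j).choose σ : ℂ) =
            (((p i j : ℝ) * ((r * i + j).choose σ : ℝ) : ℝ) : ℂ) := by simp
        rw [this, Complex.norm_real, norm_mul, Real.norm_eq_abs, Real.norm_eq_abs, Nat.abs_cast]
        have u1 := hpR i j
        have u2 := choose_le_W r A B i j σ hBr hi hj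
        gcongr
      have t2 : ‖((3 * β ^ 2 - 1) * (d : ℂ) * 10 ^ a0) ^ i‖ ≤ (36 * 10 ^ a0) ^ i := by
        rw [norm_pow]
        gcongr
        rw [norm_mul, norm_mul]
        have := h.quad_norm
        have hd' : (d : ℝ) ≤ 9 := by exact_mod_cast hd9
        have u1 : ‖(3 * β ^ 2 - 1)‖ * ‖(d : ℂ)‖ ≤ 36 := by
          rw [Complex.norm_natCast]
          nlinarith [norm_nonneg (3 * β ^ 2 - 1), (Nat.cast_nonneg d : (0 : ℝ) ≤ d)]
        have u2 : ‖(10 : ℂ) ^ a0‖ = 10 ^ a0 := by simp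
        rw [u2]; gcongr
      have t3 : ‖(9 * β ^ n0) ^ (A - 1 - i)‖ ≤ (36 * 10 ^ a0) ^ (A - i) := by
        rw [norm_pow]
        have u1 : ‖9 * β ^ n0‖ ≤ 36 * 10 ^ a0 := by
          rw [norm_mul, norm_pow]
          have := pow_le_one₀ (n := n0) (norm_nonneg _) h.norm_le
          have u3 : (1 : ℝ) ≤ 10 ^ a0 := one_le_pow₀ (by norm_num)
          simp
          linarith
        have u4 : (1 : ℝ) ≤ 36 * 10 ^ a0 := by
          have u3 : (1 : ℝ) ≤ 10 ^ a0 := one_le_pow₀ (by norm_num)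
          linarith
        exact (pow_le_pow_left₀ (norm_nonneg _) u1 _).trans (pow_le_pow_right₀ u4 (by omega))
      have t4 : ‖β ^ (n1 * j)‖ ≤ 1 := by
        rw [norm_pow]; exact pow_le_one₀ (norm_nonneg _) h.norm_le
      have t5 : ‖(10 : ℂ) ^ (a1 * (B - 1 - j))‖ ≤ 10 ^ (a1 * B) := by
        rw [norm_pow]
        simp only [Complex.norm_ofNat]
        exact pow_le_pow_right₀ (by norm_num) (Nat.mul_le_mul_left _ (by omega))
      have t6 : ((36 : ℝ) * 10 ^ a0) ^ A = (36 * 10 ^ a0) ^ i * (36 * 10 ^ a0) ^ (A - i) := by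
        rw [← pow_add]; congr 1; omega
      rw [t6]
      calc _ ≤ (H ^ 3 * 2 ^ (r * A)) * (36 * 10 ^ a0) ^ i * (36 * 10 ^ a0) ^ (A - i) * 1 * 10 ^ (a1 * B) := by
            gcongr
        _ = _ := by ring
    · rw [← hAB]; ring
  have he0 : aeval α e ≠ 0 := by
    rw [heα]; exact mul_ne_zero (by positivity) hne
  have hn := h.norm_ge e he0
  have hEα : |aeval α e| ≤ (9 * α ^ n0) ^ A * 10 ^ (a1 * B) * ((1 + ρ) ^ (r * A) * H * H ^ 3 * Z) := by
    rw [heα, abs_mul, abs_of_pos (by positivity)]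
    have u1 : (1 : ℝ) ≤ 9 * α ^ n0 := by
      have := one_le_pow₀ (n := n0) hα1
      linarith
    have u2 : (9 * α ^ n0) ^ (A - 1) ≤ (9 * α ^ n0) ^ A := pow_le_pow_right₀ u1 (by omega)
    have u3 : (10 : ℝ) ^ (a1 * (B - 1)) ≤ 10 ^ (a1 * B) :=
      pow_le_pow_right₀ (by norm_num) (Nat.mul_le_mul_left _ (by omega))
    gcongr
  calc (1 : ℝ) ≤ _ := hn
    _ ≤ ((9 * α ^ n0) ^ A * 10 ^ (a1 * B) * ((1 + ρ) ^ (r * A) * H * H ^ 3 * Z)) *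
        (H ^ 4 * (36 * 10 ^ a0) ^ A * 10 ^ (a1 * B)) ^ 2 := by gcongr
    _ = _ := by
        rw [show 3 * a1 * B = a1 * B + (a1 * B) * 2 by ring, pow_add, pow_mul _ (a1 * B) 2,
          mul_comm 2 A, pow_mul _ A 2]
        ring
end PadTS

namespace PadTS
variable {α : ℝ} {β : ℂ}

set_option exponentiation.threshold 20000 in
lemma Roots.log_lo (h : Roots α β) : 0.281 < Real.log α := by
  rw [Real.lt_log_iff_exp_lt h.pos]
  have h1 : Real.exp 0.281 ^ 1000 < α ^ 1000 := by
    rw [← Real.exp_nat_mul]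
    have e : ((1000 : ℕ) : ℝ) * 0.281 = (281 : ℕ) * 1 := by norm_num
    rw [e, Real.exp_nat_mul]
    calc Real.exp 1 ^ 281 ≤ 2.7182818286 ^ 281 :=
          pow_le_pow_left₀ (Real.exp_pos _).le Real.exp_one_lt_d9.le _
      _ < 1.3247 ^ 1000 := by norm_num
      _ ≤ α ^ 1000 := pow_le_pow_left₀ (by norm_num) h.lo.le _
  exact lt_of_pow_lt_pow_left₀ _ h.pos.le h1

set_option exponentiation.threshold 20000 in
lemma Roots.log_hi (h : Roots α β) : Real.log α < 0.2813 := by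
  rw [Real.log_lt_iff_lt_exp h.pos]
  have h1 : α ^ 10000 < Real.exp 0.2813 ^ 10000 := by
    rw [← Real.exp_nat_mul]
    have e : ((10000 : ℕ) : ℝ) * 0.2813 = (2813 : ℕ) * 1 := by norm_num
    rw [e, Real.exp_nat_mul]
    calc α ^ 10000 ≤ 1.3248 ^ 10000 := pow_le_pow_left₀ h.pos.le h.hi.le _
      _ < 2.7182818283 ^ 2813 := by norm_num
      _ ≤ Real.exp 1 ^ 2813 := pow_le_pow_left₀ (by norm_num) Real.exp_one_gt_d9.le _
  exact lt_of_pow_lt_pow_left₀ _ (Real.exp_pos _).le h1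

lemma log10_hi : Real.log 10 < 3 := by
  rw [Real.log_lt_iff_lt_exp (by norm_num)]
  have e : (3 : ℝ) = (3 : ℕ) * 1 := by norm_num
  rw [e, Real.exp_nat_mul]
  calc (10 : ℝ) < 2.7182818283 ^ 3 := by norm_num
    _ ≤ Real.exp 1 ^ 3 := pow_le_pow_left₀ (by norm_num) Real.exp_one_gt_d9.le _

lemma log10_lo : 2 < Real.log 10 := by
  rw [Real.lt_log_iff_exp_lt (by norm_num)]
  have e : (2 : ℝ) = (2 : ℕ) * 1 := by norm_num
  rw [e, Real.exp_nat_mul]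
  calc Real.exp 1 ^ 2 ≤ 2.7182818286 ^ 2 :=
          pow_le_pow_left₀ (Real.exp_pos _).le Real.exp_one_lt_d9.le _
    _ < (10 : ℝ) := by norm_num

lemma pow_le_exp {y c : ℝ} (hy : 0 < y) (k : ℕ) (h : k * Real.log y ≤ c) : y ^ k ≤ Real.exp c := by
  rw [← Real.exp_log (pow_pos hy k), Real.log_pow]
  exact Real.exp_le_exp.2 h

lemma le_exp_small (N : ℝ) (hN : 10 ^ 100 ≤ N) : N ≤ Real.exp (0.0000001 * N) := by
  have h0 : 0 ≤ 0.0000001 * N := by linarith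
  have := Real.quadratic_le_exp_of_nonneg h0
  nlinarith

set_option exponentiation.threshold 20000 in
set_option maxHeartbeats 4000000 in
theorem final_contra (h : Roots α β) (n n0 n1 a0 a1 r : ℕ) (ρ ε : ℝ)
    (hn : n = n0 + r * n1) (h30 : 30000 ≤ n1) (hr : 10 ^ 100 ≤ r)
    (hn0 : (n0 : ℝ) ≤ 1.001 * r) (ha0 : a0 * Real.log 10 ≤ 0.2826 * r + 4)
    (ha1 : a1 * Real.log 10 ≤ n1 * Real.log α + 1) (hρ0 : 0 ≤ ρ) (hρ : ρ ≤ Real.exp (-258))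
    (hε : ε ≤ Real.exp (-(0.267 * n)))
    (hmain : 1 ≤ ((4 * (n1 / 300 : ℕ) * (r / 6 : ℕ)) * 2 ^ (r * (4 * (n1 / 300)))) ^ 12 *
      (9 * α ^ n0) ^ (4 * (n1 / 300)) *
      (36 * 10 ^ a0) ^ (2 * (4 * (n1 / 300))) * 10 ^ (3 * a1 * (r / 6)) *
      (1 + ρ) ^ (r * (4 * (n1 / 300))) *
      ((r * (4 * (n1 / 300)) : ℕ) * 2 ^ (r * (4 * (n1 / 300))) *
        ρ ^ (2 * (n1 / 300) * (r / 6) - r / 6) + ε)) : False := by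
  have hω1 := h.log_hi
  have hω0 := h.log_lo
  have hα := h.pos
  have hA1 : ((n1 / 300 : ℕ) : ℝ) ≤ n1 / 300 := Nat.cast_div_le
  have hA2 : (0.99 : ℝ) * (n1 / 300) ≤ (n1 / 300 : ℕ) := by
    have : n1 < 300 * (n1 / 300) + 300 := by omega
    have h1 : (n1 : ℝ) < 300 * (n1 / 300 : ℕ) + 300 := by exact_mod_cast this
    have h2 : (30000 : ℝ) ≤ n1 := by exact_mod_cast h30
    linarith
  have hA3 : 100 ≤ n1 / 300 := by omega
  have hrR : (10 : ℝ) ^ 100 ≤ r := by exact_mod_cast hr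
  have hB1 : ((r / 6 : ℕ) : ℝ) ≤ r / 6 := Nat.cast_div_le
  have hB2 : (0.99 : ℝ) * (r / 6) ≤ (r / 6 : ℕ) := by
    have : r < 6 * (r / 6) + 6 := by omega
    have h1 : (r : ℝ) < 6 * (r / 6 : ℕ) + 6 := by exact_mod_cast this
    linarith
  set A' := n1 / 300
  set B := r / 6
  set W := r * (4 * A') with hW
  have hn1R : (30000 : ℝ) ≤ n1 := by exact_mod_cast h30
  have hA3R : (100 : ℝ) ≤ A' := by exact_mod_cast hA3
  set N : ℝ := (r : ℝ) * n1 with hN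
  have hNr : 30000 * (r : ℝ) ≤ N := by rw [hN, mul_comm]; gcongr
  have hNn1 : (10 : ℝ) ^ 100 * n1 ≤ N := by rw [hN]; gcongr
  have hNbig : (10 : ℝ) ^ 100 ≤ N := by linarith
  have hNn : N ≤ n := by
    have : r * n1 ≤ n := by omega
    rw [hN]; exact_mod_cast this
  have hWN : (W : ℝ) ≤ N / 75 := by
    have e0 : (W : ℝ) = 4 * ((r : ℝ) * A') := by rw [hW]; push_cast; ring
    have e1 : (r : ℝ) * A' ≤ r * (n1 / 300) := by gcongr
    have e2 : (r : ℝ) * (n1 / 300) = N / 300 := by rw [hN]; ring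
    linarith
  have hW0 : (0 : ℝ) ≤ W := Nat.cast_nonneg _
  have hlog2 := Real.log_two_lt_d9
  have hlog2' := Real.log_two_gt_d9
  have h2W : ((2 : ℝ) ^ W) ≤ Real.exp (0.009242 * N) := by
    apply pow_le_exp (by norm_num)
    calc (W : ℝ) * Real.log 2 ≤ (N / 75) * 0.6931471808 :=
          mul_le_mul hWN hlog2.le (by linarith) (by linarith)
      _ ≤ _ := by linarith
  -- factor 1
  have hF1 : ((4 * (A' : ℝ) * (B : ℝ)) * 2 ^ W) ^ 12 ≤ Real.exp (0.110906 * N) := by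
    have e1 : 4 * (A' : ℝ) * (B : ℝ) ≤ N := by
      have : (A' : ℝ) * B ≤ (n1 / 300) * (r / 6) := by gcongr
      have e2 : ((n1 : ℝ) / 300) * (r / 6) = N / 1800 := by rw [hN]; ring
      rw [mul_assoc]; linarith
    have e2 := e1.trans (le_exp_small N hNbig)
    calc _ ≤ (Real.exp (0.0000001 * N) * Real.exp (0.009242 * N)) ^ 12 := by gcongr
      _ = Real.exp (12 * ((0.0000001 + 0.009242) * N)) := by
          rw [← Real.exp_add, ← Real.exp_nat_mul]; congr 1; push_cast; ring
      _ ≤ _ := by apply Real.exp_le_exp.2; linarith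
  -- factor 2
  have hlog9 : Real.log 9 ≤ 8 := (Real.log_le_sub_one_of_pos (by norm_num)).trans (by norm_num)
  have hlog36 : Real.log 36 ≤ 35 := (Real.log_le_sub_one_of_pos (by norm_num)).trans (by norm_num)
  have hF2 : (9 * α ^ n0) ^ (4 * A') ≤ Real.exp (0.00376 * N) := by
    apply pow_le_exp (by positivity)
    rw [Real.log_mul (by norm_num) (by positivity), Real.log_pow]
    push_cast
    have e1 : (n0 : ℝ) * Real.log α ≤ 1.001 * r * 0.2813 := by
      apply mul_le_mul hn0 hω1.le (by linarith) (by positivity)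
    calc 4 * (A' : ℝ) * (Real.log 9 + n0 * Real.log α)
        ≤ 4 * (n1 / 300) * (8 + 1.001 * r * 0.2813) := by
          apply mul_le_mul (by linarith) (by linarith) _ (by positivity)
          have : 0 ≤ Real.log 9 := Real.log_nonneg (by norm_num)
          have : 0 ≤ (n0 : ℝ) * Real.log α := mul_nonneg (Nat.cast_nonneg _) (by linarith)
          linarith
      _ = (8 / 75) * n1 + (1.001 * 0.2813 / 75) * N := by rw [hN]; ring
      _ ≤ _ := by linarith
  have hF3 : (36 * (10 : ℝ) ^ a0) ^ (2 * (4 * A')) ≤ Real.exp (0.00754 * N) := by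
    apply pow_le_exp (by positivity)
    rw [Real.log_mul (by norm_num) (by positivity), Real.log_pow]
    push_cast
    calc 2 * (4 * (A' : ℝ)) * (Real.log 36 + a0 * Real.log 10)
        ≤ 2 * (4 * (n1 / 300)) * (39 + 0.2826 * r) := by
          apply mul_le_mul (by linarith) (by linarith) _ (by positivity)
          have : 0 ≤ Real.log 36 := Real.log_nonneg (by norm_num)
          have : 0 ≤ (a0 : ℝ) * Real.log 10 := mul_nonneg (Nat.cast_nonneg _) (by linarith [log10_lo])
          linarith
      _ = (39 * 2 / 75) * n1 + (2 * 0.2826 / 75) * N := by rw [hN]; ring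
      _ ≤ _ := by linarith
  have hF4 : (10 : ℝ) ^ (3 * a1 * B) ≤ Real.exp (0.14067 * N) := by
    apply pow_le_exp (by norm_num)
    push_cast
    have e1 : (a1 : ℝ) * Real.log 10 ≤ n1 * 0.2813 + 1 := by
      have : (n1 : ℝ) * Real.log α ≤ n1 * 0.2813 := by gcongr
      linarith
    calc 3 * (a1 : ℝ) * B * Real.log 10 = 3 * (B * (a1 * Real.log 10)) := by ring
      _ ≤ 3 * ((r / 6) * (n1 * 0.2813 + 1)) := by
          have : 0 ≤ (a1 : ℝ) * Real.log 10 := mul_nonneg (Nat.cast_nonneg _) (by linarith [log10_lo])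
          gcongr
      _ = 0.14065 * N + r / 2 := by rw [hN]; ring
      _ ≤ _ := by linarith
  have hρs : ρ ≤ 0.000001 := by
    refine hρ.trans ?_
    rw [Real.exp_neg]
    have : (1000000 : ℝ) ≤ Real.exp 258 := by
      have e : (258 : ℝ) = (258 : ℕ) * 1 := by norm_num
      rw [e, Real.exp_nat_mul]
      calc (1000000 : ℝ) ≤ 2.7182818283 ^ 258 := by norm_num
        _ ≤ Real.exp 1 ^ 258 := pow_le_pow_left₀ (by norm_num) Real.exp_one_gt_d9.le _
    rw [inv_le_comm₀ (Real.exp_pos _) (by norm_num)]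
    norm_num at this ⊢
    exact this
  have hF5 : (1 + ρ) ^ W ≤ Real.exp (0.000001 * N) := by
    apply pow_le_exp (by linarith)
    have e1 : Real.log (1 + ρ) ≤ ρ := by
      have := Real.log_le_sub_one_of_pos (show 0 < 1 + ρ by linarith)
      linarith
    calc (W : ℝ) * Real.log (1 + ρ) ≤ W * 0.000001 := by gcongr; linarith
      _ ≤ _ := by linarith
  have hm : 0.00108 * N ≤ ((2 * A' * B - B : ℕ) : ℝ) := by
    have e0 : B ≤ 2 * A' * B := Nat.le_mul_of_pos_left _ (by omega)
    rw [Nat.cast_sub e0]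
    push_cast
    have e1 : (0.99 * (n1 / 300)) * (0.99 * (r / 6)) ≤ (A' : ℝ) * B := by gcongr
    have e2 : 100 * (B : ℝ) ≤ A' * B := by gcongr
    have e3 : (0.99 * ((n1 : ℝ) / 300)) * (0.99 * (r / 6)) = (0.9801 / 1800) * N := by rw [hN]; ring
    rw [e3] at e1
    have e4 : 2 * (A' : ℝ) * B - B = 2 * (A' * B) - B := by ring
    rw [e4]
    linarith
  have hρm : ρ ^ (2 * A' * B - B) ≤ Real.exp (-(0.27864 * N)) := by
    calc ρ ^ (2 * A' * B - B) ≤ Real.exp (-258) ^ (2 * A' * B - B) := pow_le_pow_left₀ hρ0 hρ _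
      _ = Real.exp ((2 * A' * B - B : ℕ) * (-258)) := by rw [← Real.exp_nat_mul]
      _ ≤ _ := by apply Real.exp_le_exp.2; linarith
  have hWe : (W : ℝ) ≤ Real.exp (0.0000001 * N) := by
    have := le_exp_small N hNbig
    linarith
  have hε0 : ε ≤ Real.exp (-(0.267 * N)) := hε.trans (by apply Real.exp_le_exp.2; linarith)
  have hlast : (W : ℝ) * 2 ^ W * ρ ^ (2 * A' * B - B) + ε ≤ 2 * Real.exp (-(0.267 * N)) := by
    have : (W : ℝ) * 2 ^ W * ρ ^ (2 * A' * B - B) ≤ Real.exp (-(0.267 * N)) := by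
      calc _ ≤ Real.exp (0.0000001 * N) * Real.exp (0.009242 * N) * Real.exp (-(0.27864 * N)) := by
            gcongr
        _ = Real.exp (-(0.2693979 * N)) := by
            rw [← Real.exp_add, ← Real.exp_add]; congr 1; ring
        _ ≤ _ := by apply Real.exp_le_exp.2; linarith
    linarith
  have hall := hmain.trans (mul_le_mul (mul_le_mul (mul_le_mul (mul_le_mul (mul_le_mul hF1 hF2
    (by positivity) (Real.exp_pos _).le) hF3 (by positivity) (by positivity)) hF4 (by positivity)
    (by positivity)) hF5 (by positivity) (by positivity)) hlast ?_ (by positivity))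
  · rw [← Real.exp_add, ← Real.exp_add, ← Real.exp_add, ← Real.exp_add, mul_left_comm,
      ← Real.exp_add] at hall
    have e1 : Real.exp (0.110906 * N + 0.00376 * N + 0.00754 * N + 0.14067 * N + 0.000001 * N
        + -(0.267 * N)) ≤ Real.exp (-2) := by
      apply Real.exp_le_exp.2
      linarith
    have e2 : Real.exp (-2) < 1 / 2 := by
      rw [Real.exp_neg, inv_lt_comm₀ (Real.exp_pos _) (by norm_num)]
      have := Real.add_one_le_exp (2 : ℝ)
      norm_num; linarith
    linarith
  · by_contra hneg
    push Not at hneg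
    have : ((4 * (A' : ℝ) * (B : ℝ)) * 2 ^ W) ^ 12 * (9 * α ^ n0) ^ (4 * A') *
      (36 * 10 ^ a0) ^ (2 * (4 * A')) * 10 ^ (3 * a1 * B) * (1 + ρ) ^ W *
      ((W : ℝ) * 2 ^ W * ρ ^ (2 * A' * B - B) + ε) ≤ 0 :=
      mul_nonpos_of_nonneg_of_nonpos (by positivity) hneg.le
    linarith
end PadTS

namespace PadTS
variable {α : ℝ} {β : ℂ}

lemma abs_log_le {y ε : ℝ} (h : |y - 1| ≤ ε) (hε : ε ≤ 1 / 2) : 0 < y ∧ |Real.log y| ≤ 1 := by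
  have h1 := abs_le.1 h
  have hy : 0 < y := by linarith
  refine ⟨hy, ?_⟩
  have h2 := Real.log_le_sub_one_of_pos hy
  have h3 := Real.one_sub_inv_le_log_of_pos hy
  have h4 : y⁻¹ ≤ 2 := by
    rw [inv_le_comm₀ hy (by norm_num)]; linarith
  rw [abs_le]
  constructor <;> linarith

lemma exp_sub_one_le {u : ℝ} (h : |u| ≤ 1) : |Real.exp u - 1| ≤ 2 * |u| := by
  have := Real.abs_exp_sub_one_le h
  simpa using this

/-- Dirichlet approximation step, giving `n1, a1`. -/
lemma dirichlet_step (h : Roots α β) (Q : ℕ) (hQ : 10 ^ 120 ≤ Q) :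
    ∃ n1 a1 : ℕ, 30000 ≤ n1 ∧ n1 ≤ Q ∧ |n1 * Real.log α - a1 * Real.log 10| ≤ 90000 / Q := by
  have hω0 := h.log_lo
  have hω1 := h.log_hi
  have hL0 := log10_lo
  have hL1 := log10_hi
  have hQ0 : 0 < Q := by
    have : 0 < 10 ^ 120 := by positivity
    omega
  have hQR : (10 : ℝ) ^ 120 ≤ Q := by exact_mod_cast hQ
  obtain ⟨j, k, hk0, hkQ, hjk⟩ := Real.exists_int_int_abs_mul_sub_le (Real.log α / Real.log 10) hQ0
  have hξ : 0 < Real.log α / Real.log 10 := div_pos (by linarith) (by linarith)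
  have hj : 0 ≤ j := by
    by_contra hj
    have hj' : (j : ℝ) ≤ -1 := by exact_mod_cast (by omega : j ≤ -1)
    have h1 := (abs_le.1 hjk).2
    have h2 : (0 : ℝ) < k * (Real.log α / Real.log 10) := mul_pos (by exact_mod_cast hk0) hξ
    have h3 : (1 : ℝ) / (Q + 1) ≤ 1 := by
      rw [div_le_one (by positivity)]; linarith
    linarith
  lift j to ℕ using hj
  lift k to ℕ using hk0.le
  have hk0' : 0 < k := by exact_mod_cast hk0
  have hkQ' : k ≤ Q := by exact_mod_cast hkQ
  have hb : |(k : ℝ) * Real.log α - j * Real.log 10| ≤ 3 / Q := by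
    have e : (k : ℝ) * Real.log α - j * Real.log 10
        = (k * (Real.log α / Real.log 10) - j) * Real.log 10 := by
      field_simp
    rw [e, abs_mul, abs_of_pos (by linarith : 0 < Real.log 10)]
    have hq : (1 : ℝ) / (Q + 1) ≤ 1 / Q := by
      apply one_div_le_one_div_of_le <;> [exact_mod_cast hQ0; linarith]
    calc _ ≤ (1 / (Q : ℝ)) * 3 := by
          apply mul_le_mul _ hL1.le (by linarith) (by positivity)
          push_cast at hjk
          linarith
      _ = _ := by ring
  by_cases hk : 30000 ≤ k
  · refine ⟨k, j, hk, hkQ', hb.trans ?_⟩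
    gcongr; norm_num
  · refine ⟨30000 * k, 30000 * j, by omega, ?_, ?_⟩
    · have : 30000 * 30000 ≤ 10 ^ 120 := by norm_num
      omega
    · push_cast
      have e : 30000 * (k : ℝ) * Real.log α - 30000 * j * Real.log 10
        = 30000 * (k * Real.log α - j * Real.log 10) := by ring
      rw [e, abs_mul, abs_of_pos (by norm_num : (0 : ℝ) < 30000)]
      calc _ ≤ 30000 * (3 / (Q : ℝ)) := by gcongr
        _ = _ := by ring

/-- parameters `r, n0`. -/
lemma param_step (n Q n1 : ℕ) (hQ : 10 ^ 120 ≤ Q) (hQn : Q * Q ≤ n) (hnQ : n ≤ Q * Q + 2 * Q)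
    (h30 : 30000 ≤ n1) (hn1 : n1 ≤ Q) :
    ∃ r n0 : ℕ, n = n0 + r * n1 ∧ 10 ^ 100 ≤ r ∧ (n0 : ℝ) ≤ 1.001 * r ∧
      (r : ℝ) * (90000 / Q) + 20 ≤ 0.28 * n0 ∧ (r : ℝ) * (90000 / Q) ≤ 0.0001 * r ∧
      (Q : ℝ) / 2 ≤ r := by
  set T := 400000 * Q / n1 + 100 with hT
  have hn1p : 0 < n1 := by omega
  have hT1 : T ≤ 15 * Q := by
    have : 400000 * Q / n1 ≤ 400000 * Q / 30000 := Nat.div_le_div_left h30 (by norm_num)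
    omega
  have hbig : 10 ^ 120 ≤ Q := hQ
  have hTn : T ≤ n := by nlinarith
  have hTn1 : (T : ℝ) * n1 ≤ 400000 * Q + 100 * n1 := by
    have : 400000 * Q / n1 * n1 ≤ 400000 * Q := Nat.div_mul_le_self _ _
    have : T * n1 ≤ 400000 * Q + 100 * n1 := by rw [hT, add_mul]; omega
    exact_mod_cast this
  have hTlo : 400000 * (Q : ℝ) / n1 + 99 ≤ T := by
    have : 400000 * Q < (400000 * Q / n1 + 1) * n1 := by
      have := Nat.lt_div_mul_add hn1p (a := 400000 * Q)
      rw [add_mul]; omega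
    have h2 : (400000 : ℝ) * Q < (((400000 * Q / n1 : ℕ) : ℝ) + 1) * n1 := by exact_mod_cast this
    have h3 : 400000 * (Q : ℝ) / n1 ≤ ((400000 * Q / n1 : ℕ) : ℝ) + 1 := by
      rw [div_le_iff₀ (by exact_mod_cast hn1p)]; exact h2.le
    rw [hT]; push_cast; push_cast at h3; linarith
  have hdm := Nat.div_add_mod' (n - T) n1
  have hmod := Nat.mod_lt (n - T) hn1p
  set r := (n - T) / n1 with hr
  set s := (n - T) % n1 with hs
  have hneq : n = (T + s) + r * n1 := by omega
  have hQR : (10 : ℝ) ^ 120 ≤ Q := by exact_mod_cast hQ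
  have hn1R : (n1 : ℝ) ≤ Q := by exact_mod_cast hn1
  have h30R : (30000 : ℝ) ≤ n1 := by exact_mod_cast h30
  have hrn1 : (Q : ℝ) * Q - 16 * Q ≤ r * n1 := by
    have e1 : Q * Q ≤ 16 * Q + r * n1 := by omega
    have e2 : (Q : ℝ) * Q ≤ 16 * Q + r * n1 := by exact_mod_cast e1
    linarith
  have hrn1' : (r : ℝ) * n1 ≤ Q * Q + 2 * Q := by
    have e0 : r * n1 ≤ n - T := Nat.div_mul_le_self _ _
    have e1 : r * n1 ≤ Q * Q + 2 * Q := e0.trans ((Nat.sub_le _ _).trans hnQ)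
    exact_mod_cast e1
  have hrQ : (Q : ℝ) - 16 ≤ r := by
    have : ((Q : ℝ) - 16) * Q ≤ r * Q := by
      calc ((Q : ℝ) - 16) * Q = Q * Q - 16 * Q := by ring
        _ ≤ r * n1 := hrn1
        _ ≤ r * Q := by gcongr
    exact le_of_mul_le_mul_right this (by linarith)
  have hsn1 : (s : ℝ) ≤ n1 := by exact_mod_cast hmod.le
  refine ⟨r, T + s, hneq, ?_, ?_, ?_, ?_, by linarith⟩
  · have : (10 : ℝ) ^ 100 ≤ r := by linarith
    exact_mod_cast this
  · push_cast
    have : ((T : ℝ) + s) * n1 ≤ (1.001 * r) * n1 := by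
      have e1 : (s : ℝ) * n1 ≤ Q * Q := by
        apply mul_le_mul (by linarith) hn1R (by positivity) (by positivity)
      have e2 : (10 : ℝ) ^ 120 * Q ≤ Q * Q := by gcongr
      have e3 : 1.001 * ((Q : ℝ) * Q - 16 * Q) ≤ 1.001 * (r * n1) := by gcongr
      have e4 : ((T : ℝ) + s) * n1 = T * n1 + s * n1 := by ring
      have e5 : (1.001 * (r : ℝ)) * n1 = 1.001 * (r * n1) := by ring
      rw [e4, e5]
      linarith
    exact le_of_mul_le_mul_right this (by linarith)
  · push_cast
    have hQp : (0 : ℝ) < Q := by linarith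
    have e1 : (r : ℝ) * (90000 / Q) ≤ 90001 * Q / n1 := by
      rw [mul_div_assoc', div_le_div_iff₀ hQp (by linarith)]
      have e2 : (10 : ℝ) ^ 120 * Q ≤ Q * Q := by gcongr
      calc (r : ℝ) * 90000 * n1 = 90000 * (r * n1) := by ring
        _ ≤ 90000 * (Q * Q + 2 * Q) := by gcongr
        _ ≤ 90001 * (Q * Q) := by linarith
        _ = _ := by ring
    have e3 : 0 ≤ (Q : ℝ) / n1 := by positivity
    have e4 : 90001 * (Q : ℝ) / n1 = 90001 * (Q / n1) := by ring
    have e5 : 400000 * (Q : ℝ) / n1 = 400000 * (Q / n1) := by ring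
    rw [e4] at e1
    rw [e5] at hTlo
    have : (0 : ℝ) ≤ s := Nat.cast_nonneg _
    linarith
  · have hQp : (0 : ℝ) < Q := by linarith
    have : 90000 / (Q : ℝ) ≤ 0.0001 := by
      rw [div_le_iff₀ hQp]; linarith
    have hr0 : (0 : ℝ) ≤ r := Nat.cast_nonneg _
    calc _ ≤ (r : ℝ) * 0.0001 := by gcongr
      _ = _ := by ring

lemma rho_small (Q : ℝ) (hQ : 10 ^ 120 ≤ Q) : 200000 / Q ≤ Real.exp (-258) := by
  have h1 : Real.exp 258 ≤ 10 ^ 113 := by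
    have e : (258 : ℝ) = (258 : ℕ) * 1 := by norm_num
    rw [e, Real.exp_nat_mul]
    calc Real.exp 1 ^ 258 ≤ 2.7182818286 ^ 258 :=
          pow_le_pow_left₀ (Real.exp_pos _).le Real.exp_one_lt_d9.le _
      _ = (2.7182818286 ^ 129) ^ 2 := by rw [← pow_mul]
      _ ≤ _ := by norm_num
  rw [Real.exp_neg, div_le_iff₀ (by linarith), ← div_eq_inv_mul, le_div_iff₀ (Real.exp_pos _)]
  calc 200000 * Real.exp 258 ≤ 200000 * 10 ^ 113 := by gcongr
    _ ≤ Q := by linarith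

set_option maxHeartbeats 1000000 in
theorem TS (h : Roots α β) (n a d : ℕ) (hd1 : 1 ≤ d) (hd9 : d ≤ 9) (hn : 10 ^ 240 ≤ n)
    (hH : |9 * α ^ n / ((3 * α ^ 2 - 1) * d * 10 ^ a) - 1| ≤ Real.exp (-(0.267 * n))) : False := by
  have hω0 := h.log_lo
  have hω1 := h.log_hi
  have hL0 := log10_lo
  have hL1 := log10_hi
  have hα := h.pos
  set L := Real.log 10 with hL
  set ω := Real.log α with hω
  set Q := Nat.sqrt n with hQdef
  have hQ : 10 ^ 120 ≤ Q := by
    rw [hQdef, Nat.le_sqrt]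
    calc 10 ^ 120 * 10 ^ 120 = 10 ^ 240 := by norm_num
      _ ≤ n := hn
  have hQR : (10 : ℝ) ^ 120 ≤ Q := by exact_mod_cast hQ
  obtain ⟨n1, a1, h30, hn1Q, hδ⟩ := dirichlet_step h Q hQ
  obtain ⟨r, n0, hneq, hr, hn0, hlow, hrs, hrQ⟩ := param_step n Q n1 hQ (Nat.sqrt_le n)
    (by have := Nat.sqrt_le_add n; rw [← hQdef] at this; omega) h30 hn1Q
  set δ := 90000 / (Q : ℝ) with hδd
  have hrR : (10 : ℝ) ^ 100 ≤ r := by exact_mod_cast hr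
  have hn1R : (30000 : ℝ) ≤ n1 := by exact_mod_cast h30
  set g : ℝ := (3 * α ^ 2 - 1) * d / 9 with hg
  have hdR1 : (1 : ℝ) ≤ d := by exact_mod_cast hd1
  have hdR9 : (d : ℝ) ≤ 9 := by exact_mod_cast hd9
  have hsq1 : 4.2 ≤ 3 * α ^ 2 - 1 := by nlinarith [h.lo]
  have hsq2 : 3 * α ^ 2 - 1 ≤ 4.3 := by nlinarith [h.lo, h.hi]
  have hg1 : 0.4 ≤ g := by rw [hg]; nlinarith
  have hg2 : g ≤ 4.3 := by rw [hg]; nlinarith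
  have hg0 : 0 < g := by linarith
  have hlg1 : Real.log g ≤ 3.3 := by
    have := Real.log_le_sub_one_of_pos hg0; linarith
  have hlg2 : -1.5 ≤ Real.log g := by
    have := Real.one_sub_inv_le_log_of_pos hg0
    have h4 : g⁻¹ ≤ 2.5 := by
      rw [inv_le_comm₀ hg0 (by norm_num)]; norm_num at hg1 ⊢; exact hg1
    linarith
  set ε := Real.exp (-(0.267 * (n : ℝ))) with hεd
  have hnR : (10 : ℝ) ^ 240 ≤ n := by exact_mod_cast hn
  have hε2 : ε ≤ 1 / 2 := by
    have : ε ≤ Real.exp (-2) := Real.exp_le_exp.2 (by linarith)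
    have e2 : Real.exp (-2) < 1 / 2 := by
      rw [Real.exp_neg, inv_lt_comm₀ (Real.exp_pos _) (by norm_num)]
      have := Real.add_one_le_exp (2 : ℝ)
      norm_num; linarith
    linarith
  obtain ⟨hy0, hly⟩ := abs_log_le hH hε2
  set y := 9 * α ^ n / ((3 * α ^ 2 - 1) * d * 10 ^ a) with hy
  have hyg : y = α ^ n / (g * 10 ^ a) := by
    rw [hy, hg]
    have : (3 * α ^ 2 - 1) ≠ 0 := by linarith
    field_simp
  have hlogy : Real.log y = n * ω - Real.log g - a * L := by
    rw [hyg, Real.log_div (by positivity) (by positivity), Real.log_mul (by positivity)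
      (by positivity), Real.log_pow, Real.log_pow]; ring
  rw [hlogy] at hly
  obtain ⟨hly1, hly2⟩ := abs_le.1 hly
  obtain ⟨hδ1, hδ2⟩ := abs_le.1 hδ
  have hnc : (n : ℝ) = n0 + r * n1 := by rw [hneq]; push_cast; ring
  have hr0 : (0 : ℝ) ≤ r := Nat.cast_nonneg _
  have hr1 : (r : ℝ) * (n1 * ω - a1 * L) ≤ r * δ := by gcongr
  have hr2 : -((r : ℝ) * δ) ≤ r * (n1 * ω - a1 * L) := by
    have := mul_le_mul_of_nonneg_left hδ1 hr0
    linarith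
  have hn00 : (0 : ℝ) ≤ n0 := Nat.cast_nonneg _
  have hn0ω1 : 0.28 * (n0 : ℝ) ≤ n0 * ω := by nlinarith
  have hn0ω2 : (n0 : ℝ) * ω ≤ (1.001 * r) * 0.2813 := by
    apply mul_le_mul hn0 hω1.le (by linarith) (by positivity)
  have hsplit : (n : ℝ) * ω - a * L = n0 * ω - (a - r * a1) * L + r * (n1 * ω - a1 * L) := by
    rw [hnc]; ring
  have hc1 : 6 ≤ ((a : ℝ) - r * a1) * L := by linarith
  have hc2 : 2 ≤ (a : ℝ) - r * a1 := by
    by_contra hc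
    push Not at hc
    have : ((a : ℝ) - r * a1) * L < 6 := by nlinarith
    linarith
  have haN : 2 + r * a1 ≤ a := by
    have : (2 : ℝ) + r * a1 ≤ a := by linarith
    exact_mod_cast this
  obtain ⟨a0, ha0⟩ : ∃ a0, a = a0 + r * a1 := ⟨a - r * a1, by omega⟩
  have ha0c : (a : ℝ) - r * a1 = a0 := by rw [ha0]; push_cast; ring
  have ha02 : 2 ≤ a0 := by omega
  rw [ha0c] at hsplit
  have ha0L : a0 * L ≤ 0.2826 * r + 4 := by linarith
  have hδs : δ ≤ 0.0001 := by
    by_contra hc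
    push Not at hc
    have : (r : ℝ) * 0.0001 < r * δ := by
      apply mul_lt_mul_of_pos_left hc; linarith
    linarith
  have ha1L : a1 * L ≤ n1 * ω + 1 := by linarith
  set ζ := α ^ n1 / 10 ^ a1 with hζ
  set x := (3 * α ^ 2 - 1) * d * 10 ^ a0 / (9 * α ^ n0) with hx
  have hxg : x = g * 10 ^ a0 / α ^ n0 := by rw [hx, hg]; field_simp
  have hx0 : 0 < x := by rw [hxg]; positivity
  have hquot : ζ ^ r / x = y := by
    rw [hyg, hxg, hζ, hneq, ha0]
    rw [div_pow, ← pow_mul, ← pow_mul, pow_add, pow_add, mul_comm n1 r, mul_comm a1 r]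
    field_simp
  have hlx : Real.log x = Real.log g + a0 * L - n0 * ω := by
    rw [hxg, Real.log_div (by positivity) (by positivity), Real.log_mul (by positivity)
      (by positivity), Real.log_pow, Real.log_pow]
  have hlx2 : |Real.log x| ≤ r * δ + 1 := by
    rw [hlx, abs_le]; constructor <;> linarith
  have hrp : (0 : ℝ) < r := by linarith
  set u := Real.log x / r with hu
  have hQp : (0 : ℝ) < Q := by linarith
  have hu1 : |u| ≤ 100000 / Q := by
    rw [hu, abs_div, abs_of_pos hrp, div_le_iff₀ hrp]
    have e1 : (100000 : ℝ) / Q * r = r * δ + (10000 / Q) * r := by rw [hδd]; ring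
    have e2 : 1 ≤ (10000 / (Q : ℝ)) * r := by
      rw [div_mul_eq_mul_div, le_div_iff₀ hQp]; linarith
    linarith
  have hρs := rho_small Q hQR
  have hu2 : |u| ≤ 1 := hu1.trans (by rw [div_le_one hQp]; linarith)
  have hρ1 : Real.exp (-258) ≤ 1 := Real.exp_le_one_iff.2 (by norm_num)
  have hthρ : |Real.exp u - 1| ≤ 200000 / Q := by
    refine (exp_sub_one_le hu2).trans ?_
    calc 2 * |u| ≤ 2 * (100000 / Q) := by gcongr
      _ = _ := by ring
  have hθr : Real.exp u ^ r = x := by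
    rw [← Real.exp_nat_mul, hu, mul_div_cancel₀ _ hrp.ne', Real.exp_log hx0]
  have hr6 : 6 ≤ r := le_trans (by norm_num) hr
  have hmain := main_ineq h n0 n1 a0 a1 r (n1 / 300) (r / 6) d (by omega) (by omega) (by omega)
    hd1 hd9 ha02 x ζ (Real.exp u) (200000 / Q) ε hx hζ (by rw [hquot]; exact hH) (Real.exp_pos _)
    hθr hthρ (hρs.trans hρ1)
  exact final_contra h n n0 n1 a0 a1 r (200000 / Q) ε hneq h30 hr hn0 ha0L ha1L (by positivity)
    hρs le_rfl hmain
end PadTS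

namespace PadTS

/-- Elements `a + b x + c x²` of `R[x]/(x³ - x - 1)`. -/
@[ext] structure Tri (R : Type*) where
  a : R
  b : R
  c : R

namespace Tri
variable {R : Type*} [CommRing R]

instance : Mul (Tri R) where
  mul u v := ⟨u.a * v.a + (u.b * v.c + u.c * v.b),
    u.a * v.b + u.b * v.a + (u.b * v.c + u.c * v.b) + u.c * v.c,
    u.a * v.c + u.b * v.b + u.c * v.a + u.c * v.c⟩

instance : One (Tri R) where
  one := ⟨1, 0, 0⟩

lemma mul_a (u v : Tri R) : (u * v).a = u.a * v.a + (u.b * v.c + u.c * v.b) := rfl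
lemma mul_b (u v : Tri R) : (u * v).b =
    u.a * v.b + u.b * v.a + (u.b * v.c + u.c * v.b) + u.c * v.c := rfl
lemma mul_c (u v : Tri R) : (u * v).c = u.a * v.c + u.b * v.b + u.c * v.a + u.c * v.c := rfl
lemma one_a : (1 : Tri R).a = 1 := rfl
lemma one_b : (1 : Tri R).b = 0 := rfl
lemma one_c : (1 : Tri R).c = 0 := rfl

instance : CommMonoid (Tri R) where
  mul_assoc u v w := by ext <;> simp only [mul_a, mul_b, mul_c] <;> ring
  one_mul u := by ext <;> simp only [mul_a, mul_b, mul_c, one_a, one_b, one_c] <;> ring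
  mul_one u := by ext <;> simp only [mul_a, mul_b, mul_c, one_a, one_b, one_c] <;> ring
  mul_comm u v := by ext <;> simp only [mul_a, mul_b, mul_c] <;> ring

/-- The root `x`. -/
def X : Tri R := ⟨0, 1, 0⟩

lemma X_a : (X : Tri R).a = 0 := rfl
lemma X_b : (X : Tri R).b = 1 := rfl
lemma X_c : (X : Tri R).c = 0 := rfl

lemma X_pow_four (n : ℕ) : (X : Tri R) ^ (n + 4) =
    ⟨(padovan n : R), (padovan (n + 2) : R), (padovan (n + 1) : R)⟩ := by
  induction n with
  | zero =>
    have : (X : Tri R) ^ (0 + 4) = X * X * X * X := by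
      simp only [pow_succ, pow_zero, one_mul, zero_add]
    rw [this]
    ext <;> simp [mul_a, mul_b, mul_c, X_a, X_b, X_c, padovan]
  | succ n ih =>
    rw [show n + 1 + 4 = (n + 4) + 1 by ring, pow_succ, ih]
    have : padovan (n + 3) = padovan (n + 1) + padovan n := by rw [padovan]
    ext <;> simp [mul_a, mul_b, mul_c, X_a, X_b, X_c, this]
    ring

lemma padovan_eq (n : ℕ) : (padovan n : R) = ((X : Tri R) ^ (n + 3)).c := by
  cases n with
  | zero =>
    have : (X : Tri R) ^ (0 + 3) = X * X * X := by
      simp only [pow_succ, pow_zero, one_mul, zero_add]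
    rw [this]
    simp [mul_a, mul_b, mul_c, X_a, X_b, X_c, padovan]
  | succ n =>
    rw [show n + 1 + 3 = n + 4 by ring, X_pow_four]

end Tri

/-- The five (extended) zeros `m = 0, -2, -3, -7, -16`, encoded by `N = n - m` and `x^(m+3) = u + w x`. -/
inductive Cls : ℕ → ℕ → ℤ → ℤ → Prop
  | c0 (n : ℕ) : Cls n n 1 1
  | c2 (n : ℕ) : Cls n (n + 2) 0 1
  | c3 (n : ℕ) : Cls n (n + 3) 1 0
  | c7 (n : ℕ) : Cls n (n + 7) (-1) 1
  | c16 (n : ℕ) : Cls n (n + 16) 4 (-3)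

open Tri in
lemma Cls.eval {R : Type*} [CommRing R] {n N : ℕ} {u w : ℤ} (h : Cls n N u w) :
    (padovan n : R) = u * ((X : Tri R) ^ N).c + w * ((X : Tri R) ^ N).b := by
  have e4 : (X : Tri R) ^ 4 = ⟨0, 1, 1⟩ := by
    have := X_pow_four (R := R) 0
    simpa [padovan] using this
  have key : (X : Tri R) ^ (n + 3) = X ^ N * ⟨(u : R), (w : R), 0⟩ := by
    cases h with
    | c0 =>
      rw [pow_add]; congr 1
      simp only [pow_succ, pow_zero, one_mul]
      ext <;> simp [mul_a, mul_b, mul_c, X_a, X_b, X_c]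
    | c2 =>
      rw [show n + 3 = n + 2 + 1 by ring, pow_succ]; congr 1
      ext <;> simp [X_a, X_b, X_c]
    | c3 =>
      conv_lhs => rw [← mul_one ((X : Tri R) ^ (n + 3))]
      congr 1
      ext <;> simp [one_a, one_b, one_c]
    | c7 =>
      rw [show n + 7 = n + 3 + 4 by ring, pow_add _ _ 4, mul_assoc, e4]
      conv_lhs => rw [← mul_one ((X : Tri R) ^ (n + 3))]
      congr 1
      ext <;> simp [mul_a, mul_b, mul_c, one_a, one_b, one_c]
    | c16 =>
      have e13 : (X : Tri R) ^ 13 = X ^ 4 * X ^ 4 * X ^ 4 * X := by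
        rw [← pow_add, ← pow_add, ← pow_succ]
      rw [show n + 16 = n + 3 + 13 by ring, pow_add _ _ 13, mul_assoc, e13, e4]
      conv_lhs => rw [← mul_one ((X : Tri R) ^ (n + 3))]
      congr 1
      ext <;> simp [mul_a, mul_b, mul_c, one_a, one_b, one_c, X_a, X_b, X_c] <;> norm_num
  rw [padovan_eq, key, mul_c]
  ring

/-! ### Computation with natural numbers modulo `q` -/

/-- force evaluation of a natural number -/
def force {β : Type} (n : ℕ) (f : ℕ → β) : β := Nat.rec (f 0) (fun k _ => f (k + 1)) n

lemma force_eq {β : Type} (n : ℕ) (f : ℕ → β) : force n f = f n := by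
  cases n <;> rfl

/-- product of triples mod `q`, continuation style -/
def mulK {β : Type} (q a b c a' b' c' : ℕ) (k : ℕ → ℕ → ℕ → β) : β :=
  force (b * c' + c * b') fun s => force (c * c') fun t =>
  force ((a * a' + s) % q) fun x => force ((a * b' + b * a' + s + t) % q) fun y =>
  force ((a * c' + b * b' + c * a' + t) % q) fun z => k x y z

/-- triple cast to `Tri (ZMod q)` -/
def toT (q a b c : ℕ) : Tri (ZMod q) := ⟨(a : ZMod q), (b : ZMod q), (c : ZMod q)⟩

lemma mulK_eq {β : Type} (q a b c a' b' c' : ℕ) (k : ℕ → ℕ → ℕ → β) :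
    ∃ x y z, mulK q a b c a' b' c' k = k x y z ∧ toT q x y z = toT q a b c * toT q a' b' c' := by
  refine ⟨_, _, _, by simp only [mulK, force_eq]; rfl, ?_⟩
  ext <;> simp [toT, Tri.mul_a, Tri.mul_b, Tri.mul_c]

/-- `k (u * y ^ e)` by binary powering with fuel -/
def powK {β : Type} (q : ℕ) (k : ℕ → ℕ → ℕ → β) : ℕ → ℕ → ℕ → ℕ → ℕ → ℕ → ℕ → ℕ → β
  | 0, _, _, _, _, a, b, c => k a b c
  | f + 1, e, ya, yb, yc, a, b, c =>
    force (e / 2) fun e' =>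
    bif Nat.beq (e % 2) 1 then
      mulK q a b c ya yb yc fun a b c => mulK q ya yb yc ya yb yc fun ya yb yc =>
        powK q k f e' ya yb yc a b c
    else mulK q ya yb yc ya yb yc fun ya yb yc => powK q k f e' ya yb yc a b c

lemma powK_eq {β : Type} (q : ℕ) (k : ℕ → ℕ → ℕ → β) (f e ya yb yc a b c : ℕ) (he : e < 2 ^ f) :
    ∃ x y z, powK q k f e ya yb yc a b c = k x y z ∧
      toT q x y z = toT q a b c * toT q ya yb yc ^ e := by
  induction f generalizing e ya yb yc a b c with
  | zero =>
    have : e = 0 := by simpa using he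
    subst this
    exact ⟨a, b, c, rfl, by simp⟩
  | succ f ih =>
    have he' : e / 2 < 2 ^ f := by rw [pow_succ] at he; omega
    rw [powK, force_eq]
    by_cases h1 : e % 2 = 1
    · have hb : Nat.beq (e % 2) 1 = true := by rw [h1]; rfl
      rw [hb, cond_true]
      obtain ⟨x1, y1, z1, h1', h2⟩ := mulK_eq q a b c ya yb yc (fun a b c =>
        mulK q ya yb yc ya yb yc fun ya yb yc => powK q k f (e / 2) ya yb yc a b c)
      rw [h1']
      obtain ⟨x2, y2, z2, h3, h4⟩ := mulK_eq q ya yb yc ya yb yc (fun ya yb yc =>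
        powK q k f (e / 2) ya yb yc x1 y1 z1)
      rw [h3]
      obtain ⟨x, y, z, h5, h6⟩ := ih (e / 2) x2 y2 z2 x1 y1 z1 he'
      refine ⟨x, y, z, h5, ?_⟩
      rw [h6, h2, h4, ← sq, ← pow_mul, mul_assoc, ← pow_succ']
      congr 2; omega
    · have hb : Nat.beq (e % 2) 1 = false := by
        have : e % 2 = 0 := by omega
        rw [this]; rfl
      rw [hb, cond_false]
      obtain ⟨x2, y2, z2, h3, h4⟩ := mulK_eq q ya yb yc ya yb yc (fun ya yb yc =>
        powK q k f (e / 2) ya yb yc a b c)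
      rw [h3]
      obtain ⟨x, y, z, h5, h6⟩ := ih (e / 2) x2 y2 z2 a b c he'
      refine ⟨x, y, z, h5, ?_⟩
      rw [h6, h4, ← sq, ← pow_mul]
      congr 2; omega

/-- `k (x ^ e)` -/
def xpowK {β : Type} (q f e : ℕ) (k : ℕ → ℕ → ℕ → β) : β := powK q k f e 0 1 0 1 0 0

lemma xpowK_eq {β : Type} (q f e : ℕ) (k : ℕ → ℕ → ℕ → β) (he : e < 2 ^ f) :
    ∃ x y z, xpowK q f e k = k x y z ∧ toT q x y z = Tri.X ^ e := by
  obtain ⟨x, y, z, h1, h2⟩ := powK_eq q k f e 0 1 0 1 0 0 he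
  refine ⟨x, y, z, h1, ?_⟩
  rw [h2]
  have : toT q 1 0 0 = 1 := by ext <;> simp [toT, Tri.one_a, Tri.one_b, Tri.one_c]
  rw [this, one_mul]
  congr 1
  ext <;> simp [toT, Tri.X_a, Tri.X_b, Tri.X_c]

/-- is `x ^ e = 1 mod q`? (needs `1 < q`) -/
def xone (q f e : ℕ) : Bool :=
  Nat.blt e (2 ^ f) && xpowK q f e fun a b c => Nat.beq (a % q) 1 && Nat.beq (b % q) 0 && Nat.beq (c % q) 0

lemma xone_spec {q f e : ℕ} (h : xone q f e = true) : (Tri.X : Tri (ZMod q)) ^ e = 1 := by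
  unfold xone at h
  rw [Bool.and_eq_true] at h
  obtain ⟨h0, h⟩ := h
  obtain ⟨x, y, z, h1, h2⟩ := xpowK_eq q f e (fun a b c =>
    Nat.beq (a % q) 1 && Nat.beq (b % q) 0 && Nat.beq (c % q) 0) (by simpa using h0)
  rw [h1] at h
  simp only [Bool.and_eq_true, Nat.beq_eq] at h
  obtain ⟨⟨ha, hb⟩, hc⟩ := h
  rw [← h2]
  ext
  · simp only [toT, Tri.one_a]
    rw [← ZMod.natCast_mod, ha]; simp
  · simp only [toT, Tri.one_b]
    rw [← ZMod.natCast_mod, hb]; simp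
  · simp only [toT, Tri.one_c]
    rw [← ZMod.natCast_mod, hc]; simp

/-- bounded universal quantifier -/
def allB : ℕ → (ℕ → Bool) → Bool
  | 0, _ => true
  | k + 1, f => f k && allB k f

lemma allB_spec {k : ℕ} {f : ℕ → Bool} (h : allB k f = true) : ∀ i < k, f i = true := by
  induction k with
  | zero => intro i hi; omega
  | succ k ih =>
    rw [allB, Bool.and_eq_true] at h
    intro i hi
    rcases Nat.lt_succ_iff_lt_or_eq.1 hi with h1 | h1
    · exact ih h.2 i h1
    · rw [h1]; exact h.1
end PadTS

namespace PadTS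

/-- `acc * y ^ e mod p` -/
def pm (p : ℕ) : ℕ → ℕ → ℕ → ℕ → ℕ
  | 0, _, _, acc => acc
  | f + 1, e, y, acc =>
    force (e / 2) fun e' => force (y * y % p) fun y' =>
    bif Nat.beq (e % 2) 1 then force (acc * y % p) fun acc' => pm p f e' y' acc'
    else pm p f e' y' acc

lemma pm_eq (p f e y acc : ℕ) (he : e < 2 ^ f) :
    ((pm p f e y acc : ℕ) : ZMod p) = acc * y ^ e := by
  induction f generalizing e y acc with
  | zero =>
    have : e = 0 := by simpa using he
    subst this
    simp [pm]
  | succ f ih =>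
    have he' : e / 2 < 2 ^ f := by rw [pow_succ] at he; omega
    rw [pm, force_eq, force_eq]
    by_cases h1 : e % 2 = 1
    · have hb : Nat.beq (e % 2) 1 = true := by rw [h1]; rfl
      rw [hb, cond_true, force_eq, ih _ _ _ he']
      simp only [ZMod.natCast_mod, Nat.cast_mul]
      rw [← sq, ← pow_mul, mul_assoc, ← pow_succ']
      congr 2; omega
    · have hb : Nat.beq (e % 2) 1 = false := by
        have : e % 2 = 0 := by omega
        rw [this]; rfl
      rw [hb, cond_false, ih _ _ _ he']
      simp only [ZMod.natCast_mod, Nat.cast_mul]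
      rw [← sq, ← pow_mul]
      congr 2; omega

/-- loop for an `A` step -/
def al (p y : ℕ) : ℕ → ℕ → Bool
  | 0, cur => Nat.beq cur 1
  | k + 1, cur => !(Nat.beq cur 1) && force (cur * y % p) (al p y k)

lemma al_spec (p y : ℕ) (hp : 1 < p) (k cur j : ℕ) (hcur : cur < p)
    (hc : (cur : ZMod p) = (y : ZMod p) ^ j)
    (h : al p y k cur = true) :
    (∀ i < k, (y : ZMod p) ^ (j + i) ≠ 1) ∧ (y : ZMod p) ^ (j + k) = 1 := by
  induction k generalizing cur j with
  | zero =>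
    rw [al, Nat.beq_eq] at h
    subst h
    refine ⟨fun i hi => by omega, ?_⟩
    rw [add_zero, ← hc]; simp
  | succ k ih =>
    rw [al, Bool.and_eq_true, force_eq] at h
    obtain ⟨h1, h2⟩ := h
    have h3 := ih (cur * y % p) (j + 1) (Nat.mod_lt _ (by omega))
      (by rw [ZMod.natCast_mod, Nat.cast_mul, hc, pow_succ]) h2
    refine ⟨fun i hi => ?_, by rw [← h3.2]; congr 1; ring⟩
    rcases Nat.eq_zero_or_pos i with h0 | h0
    · subst h0
      rw [add_zero, ← hc]
      intro h4
      have h5 : cur ≠ 1 := by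
        intro h6; subst h6
        exact absurd h1 (by decide)
      have h6 : ((cur : ℕ) : ZMod p) = ((1 : ℕ) : ZMod p) := by simpa using h4
      rw [ZMod.natCast_eq_natCast_iff', Nat.mod_eq_of_lt hcur, Nat.mod_eq_of_lt hp] at h6
      exact h5 h6
    · have := h3.1 (i - 1) (by omega)
      rwa [show j + 1 + (i - 1) = j + i by omega] at this

lemma beq_ne {a b : ℕ} : Nat.beq a b = false ↔ a ≠ b := by
  rw [← Bool.not_eq_true, Nat.beq_eq]

/-- nonvanishing of the five linear forms -/
def nz (q b c : ℕ) : Bool :=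
  !(Nat.beq (b % q) 0) && (!(Nat.beq (c % q) 0) && (!(Nat.beq ((b + c) % q) 0) &&
    (!(Nat.beq (b % q) (c % q)) && !(Nat.beq (4 * c % q) (3 * b % q)))))

lemma nz_spec {q b c : ℕ} (h : nz q b c = true) {n N : ℕ} {u w : ℤ} (hC : Cls n N u w) :
    (u : ZMod q) * c + w * b ≠ 0 := by
  simp only [nz, Bool.and_eq_true, Bool.not_eq_true', beq_ne] at h
  obtain ⟨h1, h2, h3, h4, h5⟩ := h
  intro h0
  cases hC with
  | c0 =>
    apply h3
    apply Nat.mod_eq_zero_of_dvd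
    rw [← ZMod.natCast_eq_zero_iff]
    push_cast at h0 ⊢
    linear_combination h0
  | c2 =>
    apply h1
    apply Nat.mod_eq_zero_of_dvd
    rw [← ZMod.natCast_eq_zero_iff]
    push_cast at h0 ⊢
    linear_combination h0
  | c3 =>
    apply h2
    apply Nat.mod_eq_zero_of_dvd
    rw [← ZMod.natCast_eq_zero_iff]
    push_cast at h0 ⊢
    linear_combination h0
  | c7 =>
    apply h4
    rw [← ZMod.natCast_eq_natCast_iff']
    push_cast at h0 ⊢
    linear_combination h0
  | c16 =>
    apply h5
    rw [← ZMod.natCast_eq_natCast_iff']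
    push_cast at h0 ⊢
    linear_combination h0

/-- loop for a `B` step -/
def bl (q da db dc : ℕ) : ℕ → ℕ → ℕ → ℕ → Bool
  | 0, a, b, c => Nat.beq (a % q) 1 && Nat.beq (b % q) 0 && Nat.beq (c % q) 0
  | k + 1, a, b, c => nz q b c && mulK q a b c da db dc (bl q da db dc k)

lemma bl_spec (q da db dc k a b c j : ℕ) (hc : toT q a b c = toT q da db dc ^ j)
    (h : bl q da db dc k a b c = true) :
    (∀ i < k, ∀ n N u w, Cls n N u w →
      (u : ZMod q) * (toT q da db dc ^ (j + i)).c + w * (toT q da db dc ^ (j + i)).b ≠ 0) ∧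
      toT q da db dc ^ (j + k) = 1 := by
  induction k generalizing a b c j with
  | zero =>
    refine ⟨fun i hi => by omega, ?_⟩
    rw [bl] at h
    simp only [Bool.and_eq_true, Nat.beq_eq] at h
    obtain ⟨⟨ha, hb⟩, hc'⟩ := h
    rw [add_zero, ← hc]
    ext
    · simp only [toT, Tri.one_a]
      rw [← ZMod.natCast_mod, ha]; simp
    · simp only [toT, Tri.one_b]
      rw [← ZMod.natCast_mod, hb]; simp
    · simp only [toT, Tri.one_c]
      rw [← ZMod.natCast_mod, hc']; simp
  | succ k ih =>
    rw [bl, Bool.and_eq_true] at h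
    obtain ⟨h1, h2⟩ := h
    obtain ⟨x, y, z, h3, h4⟩ := mulK_eq q a b c da db dc (bl q da db dc k)
    rw [h3] at h2
    have h5 := ih x y z (j + 1) (by rw [h4, hc, pow_succ]) h2
    refine ⟨fun i hi n N u w hC => ?_, by rw [← h5.2]; congr 1; ring⟩
    rcases Nat.eq_zero_or_pos i with h0 | h0
    · subst h0
      rw [add_zero, ← hc]
      exact nz_spec h1 hC
    · have := h5.1 (i - 1) (by omega) n N u w hC
      rwa [show j + 1 + (i - 1) = j + i by omega] at this

/-- check of an `A` step, `g = gcd L o`, `T = o / g` -/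
def stepA (M p π g T : ℕ) : Bool :=
  Nat.blt 1 p && (Nat.beq (Nat.gcd p 210) 1 && (Nat.beq (M % π) 0 && (xone p 40 π &&
    (Nat.blt g (2 ^ 40) && (Nat.blt 0 T && force (pm p 40 g 10 1 % p) fun y => al p y (T - 1) y)))))

/-- check of a `B` step, `g = gcd M π`, `T = π / g` -/
def stepB (L q o g T : ℕ) : Bool :=
  Nat.blt 1 q && (Nat.beq (Nat.gcd q 210) 1 && (Nat.beq (L % o) 0 && (Nat.blt o (2 ^ 40) &&
    (Nat.beq (pm q 40 o 10 1 % q) 1 && (Nat.blt g (2 ^ 40) && (Nat.blt 0 T &&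
      xpowK q 40 g fun a b c => bl q a b c (T - 1) a b c))))))

lemma pm_ten (p e : ℕ) (he : e < 2 ^ 40) : ((pm p 40 e 10 1 : ℕ) : ZMod p) = (10 : ZMod p) ^ e := by
  rw [pm_eq _ _ _ _ _ he]; simp

/-- the setting: `9 P_n = d 10^b (10^l - 1)` -/
structure Eqn (n N : ℕ) (u w : ℤ) (d b l : ℕ) : Prop where
  cls : Cls n N u w
  d1 : 1 ≤ d
  d9 : d ≤ 9
  eq : 9 * padovan n + d * 10 ^ b = d * 10 ^ (b + l)

lemma cop_d {p d : ℕ} (h1 : 1 ≤ d) (h9 : d ≤ 9) (hp : Nat.Coprime p 210) : Nat.Coprime p d := by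
  have h2 : Nat.Coprime p 2 := hp.coprime_dvd_right (by norm_num)
  have h3 : Nat.Coprime p 3 := hp.coprime_dvd_right (by norm_num)
  have h5 : Nat.Coprime p 5 := hp.coprime_dvd_right (by norm_num)
  have h7 : Nat.Coprime p 7 := hp.coprime_dvd_right (by norm_num)
  have h4 : Nat.Coprime p (2 * 2) := h2.mul_right h2
  have h6 : Nat.Coprime p (2 * 3) := h2.mul_right h3
  have h8 : Nat.Coprime p (2 * 2 * 2) := h4.mul_right h2
  have h9' : Nat.Coprime p (3 * 3) := h3.mul_right h3
  interval_cases d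
  · exact Nat.coprime_one_right p
  all_goals assumption

lemma Eqn.dvd_iff {n N : ℕ} {u w : ℤ} {d b l : ℕ} (h : Eqn n N u w d b l) {p : ℕ}
    (hp : Nat.gcd p 210 = 1) : (padovan n : ZMod p) = 0 ↔ (10 : ZMod p) ^ l = 1 := by
  have hp' : Nat.Coprime p 210 := hp
  have hd : IsUnit ((d : ℕ) : ZMod p) := (ZMod.isUnit_iff_coprime _ _).2
    (cop_d h.d1 h.d9 hp').symm
  have h9 : IsUnit ((9 : ℕ) : ZMod p) := (ZMod.isUnit_iff_coprime _ _).2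
    (cop_d (d := 9) (by norm_num) (by norm_num) hp').symm
  have h10 : IsUnit ((10 : ℕ) : ZMod p) := (ZMod.isUnit_iff_coprime _ _).2
    (hp'.coprime_dvd_right (by norm_num)).symm
  have e : ((9 * padovan n + d * 10 ^ b : ℕ) : ZMod p) = ((d * 10 ^ (b + l) : ℕ) : ZMod p) := by
    rw [h.eq]
  push_cast at e hd h9 h10
  rw [pow_add] at e
  have e2 : (9 : ZMod p) * padovan n = (d * 10 ^ b) * (10 ^ l - 1) := by linear_combination e
  have hu := hd.mul (h10.pow b)
  constructor
  · intro h0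
    rw [h0, mul_zero] at e2
    have := (hu.mul_right_eq_zero).1 e2.symm
    linear_combination this
  · intro h0
    rw [h0, sub_self, mul_zero] at e2
    exact (h9.mul_right_eq_zero).1 e2

lemma stepA_spec {n N : ℕ} {u w : ℤ} {d b l : ℕ} (h : Eqn n N u w d b l) {M L p π g T : ℕ}
    (hM : M ∣ N) (hL : L ∣ l) (hg : g ∣ L) (hc : stepA M p π g T = true) : g * T ∣ l := by
  simp only [stepA, Bool.and_eq_true, Nat.beq_eq, force_eq, Nat.blt_eq] at hc
  obtain ⟨h1, h2, h3, h4, h5, h6, h7⟩ := hc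
  have hx := xone_spec h4
  have hπ : π ∣ N := (Nat.dvd_of_mod_eq_zero h3).trans hM
  have hxN : (Tri.X : Tri (ZMod p)) ^ N = 1 := by
    obtain ⟨k, rfl⟩ := hπ
    rw [pow_mul, hx, one_pow]
  have hP : (padovan n : ZMod p) = 0 := by
    rw [h.cls.eval, hxN]; simp [Tri.one_b, Tri.one_c]
  have h10 := (h.dvd_iff h2).1 hP
  set y := pm p 40 g 10 1 % p with hy
  have hyc : (y : ZMod p) = 10 ^ g := by rw [hy, ZMod.natCast_mod, pm_ten _ _ h5]
  have hal := al_spec p y h1 (T - 1) y 1 (Nat.mod_lt _ (by omega)) (by simp) h7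
  rw [show 1 + (T - 1) = T by omega] at hal
  obtain ⟨s, rfl⟩ := hg.trans hL
  apply mul_dvd_mul_left
  by_contra hns
  have ht : 0 < s % T := Nat.pos_of_ne_zero fun h0 => hns (Nat.dvd_of_mod_eq_zero h0)
  have htT : s % T < T := Nat.mod_lt _ h6
  have := hal.1 (s % T - 1) (by omega)
  rw [show 1 + (s % T - 1) = s % T by omega] at this
  apply this
  rw [pow_mul, ← hyc] at h10
  rw [← h10]
  conv_rhs => rw [← Nat.div_add_mod s T, pow_add, pow_mul, hal.2, one_pow, one_mul]

lemma stepB_spec {n N : ℕ} {u w : ℤ} {d b l : ℕ} (h : Eqn n N u w d b l) {M L q o g T : ℕ}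
    (hM : M ∣ N) (hL : L ∣ l) (hg : g ∣ M) (hc : stepB L q o g T = true) : g * T ∣ N := by
  simp only [stepB, Bool.and_eq_true, Nat.beq_eq, Nat.blt_eq] at hc
  obtain ⟨h1, h2, h3, h4, h5, h6, h7, h8⟩ := hc
  have ho : o ∣ l := (Nat.dvd_of_mod_eq_zero h3).trans hL
  have h10o : (10 : ZMod q) ^ o = 1 := by
    rw [← pm_ten _ _ h4, ← ZMod.natCast_mod, h5]; simp
  have h10 : (10 : ZMod q) ^ l = 1 := by
    obtain ⟨k, rfl⟩ := ho
    rw [pow_mul, h10o, one_pow]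
  have hP := (h.dvd_iff h2).2 h10
  obtain ⟨x, y, z, h9, hD⟩ := xpowK_eq q 40 g (fun a b c => bl q a b c (T - 1) a b c) h6
  rw [h9] at h8
  have hbl := bl_spec q x y z (T - 1) x y z 1 (by rw [pow_one]) h8
  rw [show 1 + (T - 1) = T by omega] at hbl
  obtain ⟨s, hs⟩ := hg.trans hM
  rw [hs]
  apply mul_dvd_mul_left
  by_contra hns
  have ht : 0 < s % T := Nat.pos_of_ne_zero fun h0 => hns (Nat.dvd_of_mod_eq_zero h0)
  have htT : s % T < T := Nat.mod_lt _ h7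
  have := hbl.1 (s % T - 1) (by omega) n N u w h.cls
  rw [show 1 + (s % T - 1) = s % T by omega] at this
  apply this
  have hXN : (Tri.X : Tri (ZMod q)) ^ N = toT q x y z ^ (s % T) := by
    rw [hs, pow_mul, ← hD]
    conv_lhs => rw [← Nat.div_add_mod s T, pow_add, pow_mul, hbl.2, one_pow, one_mul]
  rw [← hXN, ← h.cls.eval, hP]

/-- run a list of steps `(isB, p, π, o)` -/
def run (goal : ℕ) : List (Bool × ℕ × ℕ × ℕ) → ℕ → ℕ → Bool
  | [], M, _ => Nat.ble goal M
  | (true, q, π, o) :: ss, M, L =>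
    force (Nat.gcd M π) fun g => force (π / g) fun T =>
      stepB L q o g T && force (Nat.lcm M (g * T)) fun M' => run goal ss M' L
  | (false, p, π, o) :: ss, M, L =>
    force (Nat.gcd L o) fun g => force (o / g) fun T =>
      stepA M p π g T && force (Nat.lcm L (g * T)) fun L' => run goal ss M L'

lemma boot_spec {n N : ℕ} {u w : ℤ} {d b l : ℕ} (h : Eqn n N u w d b l) (hN : 0 < N) (goal : ℕ)
    (ss : List (Bool × ℕ × ℕ × ℕ)) (M L : ℕ) (hM : M ∣ N) (hL : L ∣ l)
    (hr : run goal ss M L = true) : goal ≤ N := by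
  induction ss generalizing M L with
  | nil =>
    rw [run] at hr
    rw [Nat.ble_eq] at hr
    exact hr.trans (Nat.le_of_dvd hN hM)
  | cons s ss ih =>
    obtain ⟨isB, p, π, o⟩ := s
    cases isB
    · simp only [run, force_eq, Bool.and_eq_true] at hr
      exact ih M _ hM (Nat.lcm_dvd hL (stepA_spec h hM hL (Nat.gcd_dvd_left _ _) hr.1)) hr.2
    · simp only [run, force_eq, Bool.and_eq_true] at hr
      exact ih _ L (Nat.lcm_dvd hM (stepB_spec h hM hL (Nat.gcd_dvd_left _ _) hr.1)) hL hr.2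
end PadTS

namespace PadTS

/-- bootstrap data: `(isB, p, period, order of 10)` -/
def bootData : List (Bool × ℕ × ℕ × ℕ) :=
  [(false, 101, 100, 4), (false, 211, 210, 30), (true, 271, 270, 5), (false, 19, 180, 18),
   (true, 181, 10920, 180), (false, 5851, 5850, 1950), (false, 701, 491400, 700),
   (true, 79, 3120, 13), (true, 210601, 210600, 5850), (false, 4051, 810, 4050),
   (true, 379081, 379080, 21060), (true, 251, 63000, 50), (true, 286651, 286650, 8190),
   (false, 883, 882, 441), (true, 550369, 550368, 68796), (false, 449, 224, 32),
   (true, 97, 3136, 96), (false, 329281, 47040, 164640), (true, 96769, 48384, 3024),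
   (true, 25601, 25600, 25), (false, 384001, 384000, 96000), (true, 122501, 122500, 4900),
   (false, 160001, 80000, 1250), (true, 24697, 24696, 24696), (true, 4801, 768320, 800),
   (true, 473089, 473088, 2688), (false, 202753, 202752, 202752), (true, 286721, 286720, 71680),
   (true, 34849, 17424, 99), (true, 148721, 148720, 220), (false, 246403, 246402, 123201),
   (true, 2549, 2165800, 2548), (false, 103, 3536, 34), (true, 2311, 2670360, 231),
   (false, 13873, 13872, 13872), (true, 113, 4256, 112), (false, 191, 7296, 95),
   (true, 11551, 133425600, 1925), (false, 21661, 10830, 7220), (true, 137, 391, 8),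
   (false, 599, 598, 299), (true, 9521, 18129888, 595), (false, 33857, 16928, 33856),
   (true, 521, 45240, 52), (false, 59, 58, 58), (true, 61, 930, 60), (false, 373, 139128, 186),
   (true, 193751, 2346215625, 19375), (true, 31249, 108500000, 1736),
   (false, 6263, 388368, 6262), (false, 653, 427063, 326), (true, 3329, 61568, 832),
   (false, 149, 925, 148), (true, 69191, 4787394480, 34595), (true, 4591, 1317330, 2295),
   (false, 83, 2296, 41), (true, 13121, 86080320, 6560), (true, 9803, 96098808, 4901),
   (false, 173, 172, 43), (true, 55901, 3124921800, 55900), (true, 204973, 1000331684, 51243),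
   (false, 12641, 674240, 3160), (true, 3697, 1952544, 1232), (true, 751, 94000, 125),
   (false, 659, 434280, 658), (true, 216481, 3124268224, 36080), (true, 953, 454104, 952),
   (false, 107, 2862, 53), (true, 25229, 106083740, 25228), (false, 13457, 13456, 13456),
   (true, 140449, 1972592160, 3344), (true, 3541, 12538680, 20), (false, 827, 341964, 413),
   (true, 6961, 16151840, 3480), (true, 1951, 3806400, 195), (false, 249857, 124928, 249856),
   (true, 4019, 5384120, 4018), (false, 1609, 2588880, 201), (true, 188941, 11899567160, 188940),
   (false, 439, 193161, 219), (false, 1511, 2284633, 755), (true, 709, 167560, 708),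
   (false, 569, 323760, 284), (true, 362951, 32933357100, 181475), (true, 293, 6132, 146),
   (true, 266449, 70995069600, 66612), (true, 2213, 4897368, 553),
   (true, 112337, 56337507, 16048), (true, 3319, 688485, 553), (false, 167, 166, 166),
   (true, 558091, 23958889560, 111618), (true, 1423, 2024928, 158), (true, 2521, 1588860, 630),
   (false, 389, 75660, 388), (true, 607, 606, 202), (true, 617, 63448, 88),
   (false, 619, 63860, 618), (true, 194671, 37896798240, 19467), (true, 641, 68480, 32),
   (false, 643, 413448, 107), (true, 364657, 395758118, 364656),
   (true, 453961, 68693529840, 56745), (true, 91591, 4194455640, 15265),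
   (true, 7193, 25869624, 7192), (false, 1091, 49595, 1090), (true, 499, 249501, 498),
   (true, 677, 114582, 338), (false, 227, 51528, 113), (false, 122719, 20801040, 61359),
   (true, 25537, 652138368, 25536), (true, 5333, 2370074, 1333), (false, 2287, 871728, 762),
   (false, 1543, 2382393, 1542), (true, 32257, 148644864, 3584), (true, 24103, 580954608, 2678),
   (false, 263, 34584, 262), (true, 480509, 480508, 3668), (true, 4657, 2710956, 1552),
   (false, 1097, 1096, 1096), (true, 150151, 22545322800, 75075), (true, 1667, 99246, 833),
   (false, 557, 17236, 278), (true, 10429, 54382020, 948), (true, 269, 72631, 268),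
   (true, 372367, 138657182688, 372366), (true, 941, 885480, 940), (true, 977, 318176, 976),
   (true, 390223, 50757996576, 130074), (true, 7681, 3933184, 1920), (false, 2339, 2338, 2338),
   (true, 224449, 3598382400, 1336), (true, 15569, 121196880, 7784),
   (true, 538721, 2591252820, 9620), (true, 10739, 115326120, 10738), (true, 1811, 546620, 1810),
   (true, 65521, 715500240, 16380), (true, 4201, 588280, 75), (true, 7333, 17924296, 611),
   (false, 773, 298764, 193), (true, 178333, 1514412328, 6369), (false, 6067, 36814557, 3033),
   (true, 14197, 201569007, 91), (true, 18911, 119208640, 9455),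
   (true, 77617, 6024398688, 77616), (true, 7561, 476406, 1890), (false, 797, 105868, 199),
   (true, 4219, 2966660, 4218), (true, 4013, 16104168, 34), (false, 2677, 2676, 223),
   (true, 399617, 159693746688, 399616), (true, 907, 205662, 151), (false, 5449, 5938320, 2724),
   (true, 1831, 223504, 305), (true, 17707, 104512616, 8853), (true, 2389, 5707320, 2388),
   (false, 479, 229440, 239), (false, 222269, 5364116, 222268), (true, 5783, 33443088, 5782),
   (true, 3011, 3022040, 3010), (false, 599387, 21133222104, 299693),
   (true, 147391, 21724106880, 24565), (true, 126001, 15876252, 7875),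
   (true, 4111, 1408360, 2055), (true, 131071, 8589803520, 3855), (true, 12097, 36584352, 4032),
   (true, 138337, 6379041856, 138336), (true, 2689, 2410240, 42), (true, 3793, 4795616, 1264),
   (true, 3323, 11042328, 1661), (true, 1123, 52547, 561), (true, 12973, 8014843, 2162),
   (true, 17579, 25751770, 17578), (true, 1229, 62935, 1228), (true, 6841, 70908, 855),
   (true, 193441, 18709710240, 32240), (true, 1877, 880782, 938), (false, 1879, 626, 313),
   (true, 448843, 33576673108, 224421), (true, 1901, 150575, 380), (true, 661, 109230, 220),
   (false, 13903, 8786064, 13902), (true, 59581, 147912315, 59580),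
   (true, 220447, 24298439904, 220446), (true, 5393, 9694816, 5392),
   (true, 3469, 12033960, 3468), (true, 27919, 779470560, 13959), (true, 3529, 622692, 1764),
   (true, 28001, 784056000, 3500), (true, 8807, 38781624, 8806), (true, 7459, 13909170, 7458),
   (true, 2273, 1722176, 2272)]

set_option maxRecDepth 1000000 in
lemma boot_run : run (10 ^ 242) bootData 4200 1 = true := by
  decide +kernel

theorem boot {n N : ℕ} {u w : ℤ} {d b l : ℕ} (h : Eqn n N u w d b l) (hN : 0 < N)
    (hM : 4200 ∣ N) : 10 ^ 242 ≤ N :=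
  boot_spec h hN _ bootData 4200 1 hM (one_dvd _) boot_run
end PadTS

namespace PadTS
open Tri

lemma X56 : (X : Tri ℤ) ^ 56 = ⟨1221537, 2143648, 1618192⟩ := by
  rw [show (56 : ℕ) = 52 + 4 by norm_num, X_pow_four]
  have h : ∀ n, padovan (n + 3) = padovan (n + 1) + padovan n := fun n => by rw [padovan]
  ext <;> simp [h, padovan]

lemma X_two (i : ℕ) : ∃ a b c : ℤ, (X : Tri ℤ) ^ (56 * 2 ^ i) =
    ⟨1 + 2 ^ (i + 4) * a, 2 ^ (i + 4) * b, 2 ^ (i + 4) * c⟩ ∧ b % 4 = 2 ∧ c % 4 = 1 := by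
  induction i with
  | zero =>
    refine ⟨76346, 133978, 101137, ?_, by norm_num, by norm_num⟩
    rw [pow_zero, mul_one, X56]
    ext <;> norm_num
  | succ i ih =>
    obtain ⟨a, b, c, h, hb, hc⟩ := ih
    refine ⟨a + 8 * 2 ^ i * (a ^ 2 + 2 * b * c),
      b + 4 * (2 ^ (i + 2) * a * b + 2 ^ (i + 2) * b * c + 2 ^ (i + 1) * c ^ 2),
      c + 4 * (2 ^ (i + 2) * a * c + 2 ^ (i + 1) * (b ^ 2 + c ^ 2)), ?_, by omega, by omega⟩
    rw [pow_succ, ← mul_assoc, pow_mul, h, sq]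
    ext
    · simp only [mul_a]; ring
    · simp only [mul_b]; ring
    · simp only [mul_c]; ring

lemma X_two_mul (i t : ℕ) : ∃ a b c : ℤ, (X : Tri ℤ) ^ (56 * 2 ^ i * t) =
    ⟨1 + 2 ^ (i + 4) * a, 2 ^ (i + 4) * b, 2 ^ (i + 4) * c⟩ ∧ b % 4 = 2 * t % 4 ∧ c % 4 = t % 4 := by
  obtain ⟨a0, b0, c0, h0, hb0, hc0⟩ := X_two i
  induction t with
  | zero =>
    refine ⟨0, 0, 0, ?_, by norm_num, by norm_num⟩
    ext <;> simp [one_a, one_b, one_c]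
  | succ t ih =>
    obtain ⟨a, b, c, h, hb, hc⟩ := ih
    refine ⟨a + a0 + 2 ^ (i + 4) * (a * a0 + b * c0 + c * b0),
      b + b0 + 4 * (2 ^ (i + 2) * (a * b0 + b * a0 + b * c0 + c * b0 + c * c0)),
      c + c0 + 4 * (2 ^ (i + 2) * (a * c0 + b * b0 + c * a0 + c * c0)), ?_, ?_, ?_⟩
    · rw [mul_add, mul_one, pow_add, h, h0]
      ext
      · simp only [mul_a]; ring
      · simp only [mul_b]; ring
      · simp only [mul_c]; ring
    · push_cast; omega
    · push_cast; omega

lemma b_bound {n N : ℕ} {u w : ℤ} {d b l : ℕ} (h : Eqn n N u w d b l) (hN : 0 < N)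
    (hM : 56 ∣ N) : 2 ^ b ≤ N := by
  obtain ⟨s, rfl⟩ := hM
  have hs : s ≠ 0 := by rintro rfl; simp at hN
  obtain ⟨i, t, ht, rfl⟩ := Nat.exists_eq_two_pow_mul_odd hs
  obtain ⟨a', b', c', hX, hb', hc'⟩ := X_two_mul i t
  have hP := h.cls.eval (R := ℤ)
  rw [← mul_assoc, hX] at hP
  simp only at hP
  obtain ⟨k, hk⟩ := ht
  have hne : (u * c' + w * b') % 4 ≠ 0 := by
    have hcls := h.cls
    generalize 56 * (2 ^ i * t) = N' at hcls
    cases hcls <;> omega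
  have h2 : (2 : ℤ) ^ b ∣ (padovan n : ℤ) := by
    have e : ((9 * padovan n + d * 10 ^ b : ℕ) : ℤ) = ((d * 10 ^ (b + l) : ℕ) : ℤ) := by
      rw [h.eq]
    push_cast at e
    rw [pow_add] at e
    have e2 : (9 : ℤ) * padovan n = 2 ^ b * (d * 5 ^ b * (10 ^ l - 1)) := by
      rw [show (10 : ℤ) ^ b = 2 ^ b * 5 ^ b by rw [← mul_pow]; norm_num] at e
      linear_combination e
    have e3 : (2 : ℤ) ^ b ∣ 9 * padovan n := ⟨_, e2⟩
    refine IsCoprime.dvd_of_dvd_mul_left ?_ e3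
    apply IsCoprime.pow_left
    exact ⟨-4, 1, by norm_num⟩
  have hb : b < i + 6 := by
    by_contra hcon
    have h3 : (2 : ℤ) ^ (i + 6) ∣ padovan n := (pow_dvd_pow 2 (by omega)).trans h2
    rw [hP] at h3
    have e : (u : ℤ) * (2 ^ (i + 4) * c') + w * (2 ^ (i + 4) * b') = 2 ^ (i + 4) * (u * c' + w * b') := by
      ring
    simp only [Int.cast_id] at h3
    rw [e, show i + 6 = i + 4 + 2 by ring, pow_add _ (i + 4) 2] at h3
    have h4 := (mul_dvd_mul_iff_left (by positivity : (2 : ℤ) ^ (i + 4) ≠ 0)).1 h3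
    norm_num at h4
    exact hne (Int.emod_eq_zero_of_dvd h4)
  calc 2 ^ b ≤ 2 ^ (i + 5) := Nat.pow_le_pow_right (by norm_num) (by omega)
    _ = 32 * (2 ^ i * 1) := by ring
    _ ≤ 56 * (2 ^ i * t) := by gcongr <;> omega
end PadTS

namespace PadTS
open Tri

/-- the equation of the theorem, cleared of denominators -/
structure EqE (P d₁ d₂ A B : ℕ) : Prop where
  eq : 9 * P + d₁ * 10 ^ B + d₂ = d₁ * 10 ^ A + d₂ * 10 ^ B

/-- admissible list of primes with the order data -/
def goodL (M : ℕ) : List (ℕ × ℕ) → ℕ → Bool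
  | [], _ => true
  | (p, k) :: ps, T =>
    Nat.beq (10 ^ (T * k) % p) (1 % p) && Nat.beq (M % p) 0 && Nat.blt 0 (T * k) && goodL M ps (T * k)

/-- no solution modulo the primes of the list -/
def dead (P d₁ d₂ : ℕ) (fl : Bool) : List (ℕ × ℕ) → ℕ → ℕ → ℕ → Bool
  | [], _, _, _ => false
  | (p, k) :: ps, T, a, b =>
    allB k fun i => force (a + T * i) fun a' => allB (bif fl then k else 1) fun j =>
      force (b + T * j) fun b' =>
        !(Nat.beq ((9 * P + d₁ * 10 ^ b' + d₂) % p) ((d₁ * 10 ^ a' + d₂ * 10 ^ b') % p)) ||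
          dead P d₁ d₂ fl ps (T * k) a' b'

lemma pow_modEq {p K A : ℕ} (h : 10 ^ K ≡ 1 [MOD p]) : 10 ^ (A % K) ≡ 10 ^ A [MOD p] := by
  conv_rhs => rw [← Nat.mod_add_div A K, pow_add, pow_mul]
  have := (h.pow (A / K)).mul_left (10 ^ (A % K))
  simpa using this.symm

lemma dead_spec {M Q P d₁ d₂ A B : ℕ} {fl : Bool} (hQ : Q ≡ P [MOD M]) (hE : EqE Q d₁ d₂ A B)
    (ps : List (ℕ × ℕ)) (T b : ℕ) (hT : 0 < T) (hb : b = bif fl then B % T else B)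
    (hg : goodL M ps T = true) : dead P d₁ d₂ fl ps T (A % T) b ≠ true := by
  induction ps generalizing T b with
  | nil => simp [dead]
  | cons x ps ih =>
    obtain ⟨p, k⟩ := x
    intro hd
    rw [goodL] at hg
    simp only [Bool.and_eq_true, Nat.beq_eq, Nat.blt_eq] at hg
    obtain ⟨⟨⟨h1, h2⟩, h3⟩, h4⟩ := hg
    have hk : 0 < k := by
      rcases Nat.eq_zero_or_pos k with h | h
      · simp [h] at h3
      · exact h
    rw [dead] at hd
    have hd1 := allB_spec hd (A / T % k) (Nat.mod_lt _ hk)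
    simp only [force_eq] at hd1
    rw [← Nat.mod_mul] at hd1
    have key : ∃ b', (b' = bif fl then B % (T * k) else B) ∧
        (!(Nat.beq ((9 * P + d₁ * 10 ^ b' + d₂) % p)
          ((d₁ * 10 ^ (A % (T * k)) + d₂ * 10 ^ b') % p)) ||
          dead P d₁ d₂ fl ps (T * k) (A % (T * k)) b') = true := by
      cases fl with
      | false =>
        refine ⟨B, rfl, ?_⟩
        have := allB_spec hd1 0 (by simp)
        simp only [hb, mul_zero, add_zero, cond_false] at this
        exact this
      | true =>
        refine ⟨B % (T * k), rfl, ?_⟩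
        have := allB_spec hd1 (B / T % k) (by simpa using Nat.mod_lt _ hk)
        simp only [hb, cond_true] at this
        rw [← Nat.mod_mul] at this
        exact this
    obtain ⟨b', hb', hd2⟩ := key
    rw [Bool.or_eq_true] at hd2
    rcases hd2 with hd2 | hd2
    · rw [Bool.not_eq_true', beq_ne] at hd2
      apply hd2
      have hp : 10 ^ (T * k) ≡ 1 [MOD p] := h1
      have hA := pow_modEq (A := A) hp
      have hB : 10 ^ b' ≡ 10 ^ B [MOD p] := by
        rw [hb']
        cases fl with
        | false => rfl
        | true => exact pow_modEq hp
      have hQ' : P ≡ Q [MOD p] := (hQ.of_dvd (Nat.dvd_of_mod_eq_zero h2)).symm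
      have e1 : 9 * P + d₁ * 10 ^ b' + d₂ ≡ 9 * Q + d₁ * 10 ^ B + d₂ [MOD p] :=
        ((hQ'.mul_left 9).add (hB.mul_left d₁)).add_right d₂
      have e2 : d₁ * 10 ^ (A % (T * k)) + d₂ * 10 ^ b' ≡ d₁ * 10 ^ A + d₂ * 10 ^ B [MOD p] :=
        (hA.mul_left d₁).add (hB.mul_left d₂)
      rw [hE.eq] at e1
      exact e1.trans e2.symm
    · exact ih (T * k) b' h3 hb' h4 hd2

/-- primes for the main sieve -/
def ps1 : List (ℕ × ℕ) := [(11, 2), (101, 2), (211, 15), (21001, 25)]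
/-- primes for the secondary sieve -/
def ps2 : List (ℕ × ℕ) := [(11, 2), (101, 2), (211, 15), (251, 5), (21001, 5)]
/-- modulus -/
def M1 : ℕ := 49230754210000
/-- modulus -/
def M2 : ℕ := 1235691930671

/-- surviving classes with `d₂ = 0`, `b ≥ 4` -/
def exc4 (n d₂ : ℕ) : Bool :=
  Nat.beq d₂ 0 && force (n % 4200) fun r =>
    Nat.beq r 0 || Nat.beq r 4184 || Nat.beq r 4193 || Nat.beq r 4197 || Nat.beq r 4198 ||
    Nat.beq n 9000 || Nat.beq n 11984

/-- surviving class with `b = 3` -/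
def exc3 (n d₁ d₂ b : ℕ) : Bool :=
  Nat.beq n 20942 && Nat.beq d₁ 1 && Nat.beq d₂ 8 && Nat.beq b 3

/-- fixed `b` -/
def okb (n P d₁ d₂ b v c : ℕ) : Bool :=
  !(Nat.beq v c) || exc3 n d₁ d₂ b || dead P d₁ d₂ false ps1 1 0 b

/-- check of a single residue class -/
def chk (n P : ℕ) : Bool :=
  force (P % 10000) fun v => force (v / 1000) fun d₁ => force (v % 10) fun d₂ =>
    (Nat.beq d₁ 0 || Nat.beq d₁ d₂ ||
      (okb n P d₁ d₂ 1 v (1110 * d₁ + d₂) && okb n P d₁ d₂ 2 v (1100 * d₁ + 11 * d₂) &&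
        okb n P d₁ d₂ 3 v (1000 * d₁ + 111 * d₂))) &&
    (!(Nat.beq v (1111 * d₂)) || exc4 n d₂ ||
      allB 9 fun e => Nat.beq (e + 1) d₂ || dead P (e + 1) d₂ true ps1 1 0 0)

/-- scan -/
def scan : ℕ → ℕ → ℕ → ℕ → ℕ → Bool
  | 0, _, _, _, _ => true
  | f + 1, n, p, q, r =>
    bif chk n p then force (n + 1) fun n' => force ((p + q) % M1) fun s => scan f n' q r s else false

lemma scan_spec (f n p q r : ℕ) (h : scan f n p q r = true) (h0 : p ≡ padovan n [MOD M1])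
    (h1 : q ≡ padovan (n + 1) [MOD M1]) (h2 : r ≡ padovan (n + 2) [MOD M1]) :
    ∀ i < f, ∃ P, P ≡ padovan (n + i) [MOD M1] ∧ chk (n + i) P = true := by
  induction f generalizing n p q r with
  | zero => intro i hi; omega
  | succ f ih =>
    rw [scan] at h
    by_cases hc : chk n p = true
    · rw [hc, cond_true, force_eq, force_eq] at h
      intro i hi
      cases i with
      | zero => exact ⟨p, h0, hc⟩
      | succ i =>
        have := ih (n + 1) q r _ h h1 h2 (by
          have e : padovan (n + 1 + 2) = padovan n + padovan (n + 1) := by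
            rw [show n + 1 + 2 = n + 3 by ring, padovan]; ring
          rw [e]
          exact (Nat.mod_modEq _ _).trans (h0.add h1)) i (by omega)
        rwa [show n + 1 + i = n + (i + 1) by ring] at this
    · rw [Bool.not_eq_true] at hc
      rw [hc] at h
      simp at h

set_option maxRecDepth 100000 in
lemma scan_true : scan 21000 0 0 1 1 = true := by decide +kernel

lemma xone1 : xone M1 15 21000 = true := by decide +kernel
lemma xone2 : xone M2 16 63000 = true := by decide +kernel
lemma good1 : goodL M1 ps1 1 = true := by decide +kernel
lemma good2 : goodL M2 ps2 1 = true := by decide +kernel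

/-- the secondary sieve -/
def sec : Bool :=
  [9000, 30000, 51000, 11984, 32984, 53984].all fun r =>
    xpowK M2 16 (r + 3) fun _ _ c => allB 9 fun e => dead c (e + 1) 0 true ps2 1 0 0

lemma sec_true : sec = true := by decide +kernel

end PadTS

namespace PadTS
open Tri

lemma padovan_period {M K : ℕ} (h : (X : Tri (ZMod M)) ^ K = 1) (n : ℕ) :
    padovan (n % K) ≡ padovan n [MOD M] := by
  rw [← ZMod.natCast_eq_natCast_iff, padovan_eq, padovan_eq]
  conv_rhs => rw [← Nat.mod_add_div n K]
  rw [show n % K + K * (n / K) + 3 = (n % K + 3) + K * (n / K) by ring, pow_add _ (n % K + 3), pow_mul, h,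
    one_pow, mul_one]

/-- small cases -/
def small : Bool :=
  allB 45 fun n => force (padovan n) fun P =>
    allB 4 fun k => allB 4 fun l => allB 10 fun d => allB 10 fun e =>
      Nat.beq k 0 || Nat.beq l 0 || Nat.beq d 0 || Nat.beq d e ||
      !(Nat.beq P (d * ((10 ^ k - 1) / 9) * 10 ^ l + e * ((10 ^ l - 1) / 9))) ||
      [12, 16, 21, 28, 37, 49, 65, 86, 114, 200].any fun x => Nat.beq P x

lemma small_true : small = true := by decide +kernel

lemma padovan_large (n : ℕ) (hn : 45 ≤ n) : 100000 ≤ padovan n := by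
  have key : ∀ m, 100000 ≤ padovan (m + 45) ∧ 100000 ≤ padovan (m + 46) ∧
      100000 ≤ padovan (m + 47) := by
    intro m
    induction m with
    | zero => decide +kernel
    | succ m ih =>
      have e : padovan (m + 48) = padovan (m + 46) + padovan (m + 45) := by rw [padovan]
      refine ⟨ih.2.1, ih.2.2, ?_⟩
      rw [show m + 1 + 47 = m + 48 by ring, e]
      omega
  have := (key (n - 45)).1
  rwa [Nat.sub_add_cancel hn] at this

lemma sieve {n d₁ d₂ A B : ℕ} (hE : EqE (padovan n) d₁ d₂ A B) (h1 : 1 ≤ d₁) (h9 : d₁ ≤ 9)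
    (h9' : d₂ ≤ 9) (hne : d₁ ≠ d₂) (hA : 5 ≤ A) (hB : 1 ≤ B) (hBA : B < A) :
    (d₂ = 0 ∧ 4 ≤ B ∧ (n % 4200 = 0 ∨ n % 4200 = 4184 ∨ n % 4200 = 4193 ∨ n % 4200 = 4197 ∨
      n % 4200 = 4198 ∨ n % 21000 = 9000 ∨ n % 21000 = 11984)) ∨
    (n % 21000 = 20942 ∧ d₁ = 1 ∧ d₂ = 8 ∧ B = 3) := by
  have hper := padovan_period (xone_spec xone1) n
  obtain ⟨P, hP, hc⟩ := scan_spec 21000 0 0 1 1 scan_true rfl rfl rfl (n % 21000)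
    (Nat.mod_lt _ (by norm_num))
  rw [zero_add] at hP hc
  have hQ : padovan n ≡ P [MOD M1] := (hP.trans hper).symm
  have hv : padovan n % 10000 = P % 10000 := hQ.of_dvd (by norm_num [M1])
  have hdead : ∀ b fl, (b = bif fl then B % 1 else B) → dead P d₁ d₂ fl ps1 1 0 b = true → False := by
    intro b fl hb hd
    have := dead_spec hQ hE ps1 1 b one_pos hb good1
    rw [Nat.mod_one] at this
    exact this hd
  have hE' := hE.eq
  obtain ⟨A', rfl⟩ : ∃ A', A = A' + 5 := ⟨A - 5, by omega⟩
  rw [show d₁ * 10 ^ (A' + 5) = 100000 * (d₁ * 10 ^ A') by ring] at hE'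
  generalize d₁ * 10 ^ A' = t at hE'
  generalize hPn : padovan n = Pn at hE' hv
  unfold chk at hc
  simp only [force_eq, Bool.and_eq_true, Bool.or_eq_true, Nat.beq_eq, okb, Bool.not_eq_true',
    beq_ne] at hc
  obtain ⟨hc1, hc2⟩ := hc
  rcases Nat.lt_or_ge B 4 with hB4 | hB4
  · right
    have fin : (exc3 (n % 21000) d₁ d₂ B = true) → (n % 21000 = 20942 ∧ d₁ = 1 ∧ d₂ = 8 ∧ B = 3) := by
      intro h
      simp only [exc3, Bool.and_eq_true, Nat.beq_eq] at h
      tauto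
    apply fin
    have hB' : B = 1 ∨ B = 2 ∨ B = 3 := by omega
    rcases hB' with rfl | rfl | rfl
    · have hv2 : P % 10000 = 1110 * d₁ + d₂ := by omega
      have e1 : P % 10000 / 1000 = d₁ := by omega
      have e2 : P % 10000 % 10 = d₂ := by omega
      rw [e1, e2] at hc1
      rcases hc1 with (h | h) | h
      · omega
      · omega
      · rcases h.1.1 with (h | h) | h
        · exact absurd hv2 h
        · exact h
        · exact (hdead 1 false rfl h).elim
    · have hv2 : P % 10000 = 1100 * d₁ + 11 * d₂ := by omega
      have e1 : P % 10000 / 1000 = d₁ := by omega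
      have e2 : P % 10000 % 10 = d₂ := by omega
      rw [e1, e2] at hc1
      rcases hc1 with (h | h) | h
      · omega
      · omega
      · rcases h.1.2 with (h | h) | h
        · exact absurd hv2 h
        · exact h
        · exact (hdead 2 false rfl h).elim
    · have hv2 : P % 10000 = 1000 * d₁ + 111 * d₂ := by omega
      have e1 : P % 10000 / 1000 = d₁ := by omega
      have e2 : P % 10000 % 10 = d₂ := by omega
      rw [e1, e2] at hc1
      rcases hc1 with (h | h) | h
      · omega
      · omega
      · rcases h.2 with (h | h) | h
        · exact absurd hv2 h
        · exact h
        · exact (hdead 3 false rfl h).elim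
  · left
    obtain ⟨B', rfl⟩ : ∃ B', B = B' + 4 := ⟨B - 4, by omega⟩
    rw [show d₁ * 10 ^ (B' + 4) = 10000 * (d₁ * 10 ^ B') by ring,
      show d₂ * 10 ^ (B' + 4) = 10000 * (d₂ * 10 ^ B') by ring] at hE'
    generalize d₁ * 10 ^ B' = t1 at hE'
    generalize d₂ * 10 ^ B' = t2 at hE'
    have hv2 : P % 10000 = 1111 * d₂ := by omega
    have e2 : P % 10000 % 10 = d₂ := by omega
    rw [e2] at hc2
    rcases hc2 with (h | h) | h
    · exact absurd hv2 h
    · simp only [exc4, force_eq, Bool.and_eq_true, Bool.or_eq_true, Nat.beq_eq] at h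
      omega
    · have h' := allB_spec h (d₁ - 1) (by omega)
      rw [Nat.sub_add_cancel h1, Bool.or_eq_true, Nat.beq_eq] at h'
      rcases h' with h' | h'
      · exact absurd h' hne
      · refine (hdead 0 true ?_ h').elim
        rw [cond_true, Nat.mod_one]

lemma sec_spec {n d A B r : ℕ} (hE : EqE (padovan n) d 0 A B) (h1 : 1 ≤ d) (h9 : d ≤ 9)
    (hr : n % 63000 = r)
    (h : (xpowK M2 16 (r + 3) fun _ _ c => allB 9 fun e => dead c (e + 1) 0 true ps2 1 0 0) = true) :
    False := by
  have hr' : r + 3 < 2 ^ 16 := by omega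
  have hper := padovan_period (xone_spec xone2) n
  obtain ⟨x, y, z, h2, h3⟩ := xpowK_eq M2 16 (r + 3) (fun _ _ c => allB 9 fun e =>
    dead c (e + 1) 0 true ps2 1 0 0) hr'
  rw [h2] at h
  have hz : padovan n ≡ z [MOD M2] := by
    refine hper.symm.trans ?_
    rw [← ZMod.natCast_eq_natCast_iff, padovan_eq, hr, ← h3, toT]
  have h' := allB_spec h (d - 1) (by omega)
  rw [Nat.sub_add_cancel h1] at h'
  have := dead_spec (fl := true) hz hE ps2 1 0 one_pos (by rw [cond_true, Nat.mod_one]) good2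
  rw [Nat.mod_one] at this
  exact this h'

lemma sec_kill {n d A B : ℕ} (hE : EqE (padovan n) d 0 A B) (h1 : 1 ≤ d) (h9 : d ≤ 9)
    (hn : n % 21000 = 9000 ∨ n % 21000 = 11984) : False := by
  have hs := sec_true
  unfold sec at hs
  rw [List.all_eq_true] at hs
  have h6 : n % 63000 = 9000 ∨ n % 63000 = 30000 ∨ n % 63000 = 51000 ∨ n % 63000 = 11984 ∨
      n % 63000 = 32984 ∨ n % 63000 = 53984 := by omega
  have hm : n % 63000 ∈ [9000, 30000, 51000, 11984, 32984, 53984] := by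
    simp only [List.mem_cons, List.not_mem_nil, or_false]
    exact h6
  exact sec_spec hE h1 h9 rfl (hs _ hm)

lemma xone32 : xone 32 7 112 = true := by decide +kernel

lemma kill3 {n A : ℕ} (hE : EqE (padovan n) 1 8 A 3) (hA : 5 ≤ A) (hn : n % 21000 = 20942) :
    False := by
  have hper : padovan (n % 112) % 32 = padovan n % 32 := padovan_period (xone_spec xone32) n
  have h : n % 112 = 54 ∨ n % 112 = 110 := by omega
  have h0 : padovan (n % 112) % 32 = 0 := by
    rcases h with h | h
    · rw [h]; decide +kernel
    · rw [h]; decide +kernel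
  obtain ⟨A', rfl⟩ : ∃ A', A = A' + 5 := ⟨A - 5, by omega⟩
  have := hE.eq
  rw [show 1 * 10 ^ (A' + 5) = 100000 * 10 ^ A' by ring] at this
  omega

/-- what remains after the sieve -/
lemma sieve' {n d₁ d₂ A B : ℕ} (hE : EqE (padovan n) d₁ d₂ A B) (h1 : 1 ≤ d₁) (h9 : d₁ ≤ 9)
    (h9' : d₂ ≤ 9) (hne : d₁ ≠ d₂) (hA : 5 ≤ A) (hB : 1 ≤ B) (hBA : B < A) :
    ∃ N u w, Eqn n N u w d₁ B (A - B) ∧ 0 < N ∧ 4200 ∣ N ∧ n ≤ N ∧ N ≤ n + 16 := by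
  rcases sieve hE h1 h9 h9' hne hA hB hBA with ⟨rfl, h4, h⟩ | ⟨h, rfl, rfl, rfl⟩
  · have hn0 : 0 < n := by
      rcases Nat.eq_zero_or_pos n with rfl | h0
      · exfalso
        have := hE.eq
        have h2 : 10 ^ B < 10 ^ A := Nat.pow_lt_pow_right (by norm_num) hBA
        simp only [padovan] at this
        have h3 : d₁ * 10 ^ B < d₁ * 10 ^ A := Nat.mul_lt_mul_of_pos_left h2 (by omega)
        omega
      · exact h0
    have he : 9 * padovan n + d₁ * 10 ^ B = d₁ * 10 ^ (B + (A - B)) := by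
      have := hE.eq
      rw [Nat.add_sub_cancel' hBA.le]
      omega
    rcases h with h | h | h | h | h | h
    · exact ⟨n, 1, 1, ⟨.c0 n, h1, h9, he⟩, by omega, by omega, by omega, by omega⟩
    · exact ⟨n + 16, 4, -3, ⟨.c16 n, h1, h9, he⟩, by omega, by omega, by omega, by omega⟩
    · exact ⟨n + 7, -1, 1, ⟨.c7 n, h1, h9, he⟩, by omega, by omega, by omega, by omega⟩
    · exact ⟨n + 3, 1, 0, ⟨.c3 n, h1, h9, he⟩, by omega, by omega, by omega, by omega⟩
    · exact ⟨n + 2, 0, 1, ⟨.c2 n, h1, h9, he⟩, by omega, by omega, by omega, by omega⟩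
    · exact (sec_kill hE h1 h9 h).elim
  · exact (kill3 hE hA h).elim

end PadTS

namespace PadTS

variable {α : ℝ} {β : ℂ}

/-- the error term in the Binet formula -/
noncomputable def Dn (α : ℝ) (n : ℕ) : ℝ := (3 * α ^ 2 - 1) * padovan n - α ^ (n + 3)

lemma Dn_rec3 (h : Roots α β) (n : ℕ) : Dn α (n + 3) = Dn α (n + 1) + Dn α n := by
  have e : padovan (n + 3) = padovan (n + 1) + padovan n := by rw [padovan]
  have hc := h.cube
  simp only [Dn, e]
  push_cast
  linear_combination (-α ^ (n + 3)) * hc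

lemma Dn_rec2 (h : Roots α β) (n : ℕ) :
    Dn α (n + 2) = -α * Dn α (n + 1) - (α ^ 2 - 1) * Dn α n := by
  have hc := h.cube
  induction n with
  | zero =>
    simp only [Dn, padovan]
    push_cast
    linear_combination (1 - 3 * α ^ 2) * hc
  | succ n ih =>
    have := Dn_rec3 h n
    rw [show n + 1 + 2 = n + 3 by ring, show n + 1 + 1 = n + 2 by ring, this]
    linear_combination α * ih - Dn α n * hc

lemma Dn_bound (h : Roots α β) (n : ℕ) : |Dn α n| ≤ 10 := by
  have hc := h.cube
  have h1 := h.lo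
  have h2 := h.hi
  have key : ∀ n, Dn α (n + 1) ^ 2 + α * Dn α n * Dn α (n + 1) + (α ^ 2 - 1) * Dn α n ^ 2 ≤ 20 := by
    intro n
    induction n with
    | zero =>
      have e0 : Dn α 0 = -(α + 1) := by simp only [Dn, padovan]; push_cast; linear_combination -hc
      have e1 : Dn α (0 + 1) = 2 * α ^ 2 - α - 1 := by
        simp only [Dn, padovan]; push_cast; linear_combination -α * hc
      rw [e0, e1]
      nlinarith
    | succ n ih =>
      have r := Dn_rec2 h n
      rw [show n + 1 + 1 = n + 2 by ring, r]
      set x := Dn α n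
      set y := Dn α (n + 1)
      have e : (-α * y - (α ^ 2 - 1) * x) ^ 2 + α * y * (-α * y - (α ^ 2 - 1) * x) +
          (α ^ 2 - 1) * y ^ 2 = (α ^ 2 - 1) * (y ^ 2 + α * x * y + (α ^ 2 - 1) * x ^ 2) := by ring
      rw [e]
      nlinarith
  have k := key n
  rw [abs_le]
  constructor <;> nlinarith [sq_nonneg (Dn α (n + 1) + α / 2 * Dn α n)]

lemma exp_big {x : ℝ} (hx : 10 ^ 20 ≤ x) : 4000 * x ^ 4 ≤ Real.exp (0.014 * x) := by
  have h0 : 0 < x := by linarith [show (0 : ℝ) < 10 ^ 20 by positivity]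
  have h := Real.pow_div_factorial_le_exp (0.014 * x) (by positivity) 6
  refine le_trans ?_ h
  rw [le_div_iff₀ (by positivity)]
  have hf : ((Nat.factorial 6 : ℕ) : ℝ) = 720 := by norm_num [Nat.factorial]
  rw [hf, mul_pow]
  have h2 : (10 : ℝ) ^ 40 ≤ x ^ 2 := by
    calc (10 : ℝ) ^ 40 = (10 ^ 20) ^ 2 := by norm_num
      _ ≤ x ^ 2 := by gcongr
  have h4 : 0 < x ^ 4 := by positivity
  calc 4000 * x ^ 4 * 720 ≤ 0.014 ^ 6 * (10 : ℝ) ^ 40 * x ^ 4 := by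
        have : (4000 * 720 : ℝ) ≤ 0.014 ^ 6 * (10 : ℝ) ^ 40 := by norm_num
        nlinarith
    _ ≤ 0.014 ^ 6 * x ^ 2 * x ^ 4 := by gcongr
    _ = 0.014 ^ 6 * x ^ 6 := by ring

lemma final {n N d b l : ℕ} {u w : ℤ} (hE : Eqn n N u w d b l) (hN : 0 < N) (hM : 4200 ∣ N)
    (hnN : N ≤ n + 16) : False := by
  obtain ⟨α, β, h⟩ := exists_roots
  have hbig := boot hE hN hM
  have hb := b_bound hE hN (Dvd.dvd.trans (by norm_num) hM)
  have hp := h.pos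
  have h1 := h.lo
  have h2 := h.hi
  have hn0 : 10 ^ 240 ≤ n := by
    have : (10 : ℕ) ^ 240 + 16 ≤ 10 ^ 242 := by norm_num
    omega
  have hn : 10 ^ 240 ≤ n + 3 := by omega
  refine TS h (n + 3) (b + l) d hE.d1 hE.d9 hn ?_
  have hD := abs_le.1 (Dn_bound h n)
  have hDe : (3 * α ^ 2 - 1) * (padovan n : ℝ) = α ^ (n + 3) + Dn α n := by rw [Dn]; ring
  have heq : 9 * (padovan n : ℝ) + d * 10 ^ b = d * 10 ^ (b + l) := by exact_mod_cast hE.eq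
  have hd1 : (1 : ℝ) ≤ d := by exact_mod_cast hE.d1
  have hd9 : (d : ℝ) ≤ 9 := by exact_mod_cast hE.d9
  have hx20 : (10 : ℝ) ^ 20 ≤ ((n + 3 : ℕ) : ℝ) := by
    have h20 : (10 : ℕ) ^ 20 ≤ 10 ^ 240 := Nat.pow_le_pow_right (by norm_num) (by norm_num)
    exact_mod_cast h20.trans hn
  have hNx : (N : ℝ) ≤ 2 * ((n + 3 : ℕ) : ℝ) := by
    have h20 : (10 : ℕ) ^ 2 ≤ 10 ^ 240 := Nat.pow_le_pow_right (by norm_num) (by norm_num)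
    have : N ≤ 2 * (n + 3) := by omega
    exact_mod_cast this
  generalize hm : n + 3 = m at *
  set x : ℝ := (m : ℝ) with hx
  have hx0 : 0 < x := by linarith [show (0 : ℝ) < 10 ^ 20 by positivity]
  -- growth of α ^ m
  have hα : Real.exp (0.281 * x) ≤ α ^ m := by
    rw [← Real.exp_log (pow_pos hp m), Real.log_pow]
    apply Real.exp_le_exp.2
    have := h.log_lo
    rw [mul_comm]
    exact mul_le_mul_of_nonneg_left this.le hx0.le
  have hexp := exp_big hx20
  have hsplit : Real.exp (0.281 * x) = Real.exp (0.014 * x) * Real.exp (0.267 * x) := by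
    rw [← Real.exp_add]; congr 1; ring
  have h10 : (10 : ℝ) ^ b ≤ 16 * x ^ 4 := by
    have e1 : (2 : ℝ) ^ b ≤ N := by exact_mod_cast hb
    calc (10 : ℝ) ^ b ≤ 16 ^ b := by gcongr; norm_num
      _ = (2 ^ b) ^ 4 := by rw [← pow_mul, mul_comm b 4, pow_mul]; norm_num
      _ ≤ (2 * x) ^ 4 := by gcongr; linarith
      _ = 16 * x ^ 4 := by ring
  have hb1 : (1 : ℝ) ≤ 10 ^ b := one_le_pow₀ (by norm_num)
  have hbase : 4000 * x ^ 4 * Real.exp (0.267 * x) ≤ α ^ m := by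
    refine le_trans ?_ hα
    rw [hsplit]
    gcongr
  have he1 : 1 ≤ Real.exp (0.267 * x) := Real.one_le_exp (by positivity)
  have hx4 : 1 ≤ x ^ 4 := one_le_pow₀ (by linarith [show (1 : ℝ) ≤ 10 ^ 20 by norm_num])
  have hα1 : 4000 ≤ α ^ m := by nlinarith
  have hg1 : 4 < 3 * α ^ 2 - 1 := by nlinarith
  have hg2 : 3 * α ^ 2 - 1 < 5 := by nlinarith
  set g := 3 * α ^ 2 - 1 with hg
  have hP0 : (0 : ℝ) ≤ padovan n := by positivity
  have hP : α ^ m ≤ 10 * padovan n := by nlinarith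
  have hpow0 : (0 : ℝ) < 10 ^ (b + l) := by positivity
  have hA : α ^ m ≤ 10 * 10 ^ (b + l) := by nlinarith
  have hden : 0 < g * d * 10 ^ (b + l) := by positivity
  have hid : 9 * α ^ m / (g * d * 10 ^ (b + l)) - 1 =
      -(g * d * 10 ^ b + 9 * Dn α n) / (g * d * 10 ^ (b + l)) := by
    rw [div_sub_one hden.ne']
    congr 1
    linear_combination (-9) * hDe + g * heq
  rw [hid, abs_div, abs_of_pos hden, div_le_iff₀ hden, abs_neg, Real.exp_neg]
  have hnum : |g * d * 10 ^ b + 9 * Dn α n| ≤ g * d * (24 * 10 ^ b) := by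
    have hgd : 4 ≤ g * d := by nlinarith
    have hgd2 : 4 ≤ g * d * 10 ^ b := by nlinarith
    rw [abs_le]
    constructor <;> linarith [hD.1, hD.2]
  refine hnum.trans ?_
  rw [show (Real.exp (0.267 * x))⁻¹ * (g * d * 10 ^ (b + l)) =
    g * d * (10 ^ (b + l) / Real.exp (0.267 * x)) by field_simp]
  have hgd0 : 0 ≤ g * d := by positivity
  apply mul_le_mul_of_nonneg_left _ hgd0
  rw [le_div_iff₀ (by positivity)]
  have : 24 * 10 ^ b * Real.exp (0.267 * x) ≤ 400 * x ^ 4 * Real.exp (0.267 * x) := by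
    apply mul_le_mul_of_nonneg_right _ (Real.exp_pos _).le
    linarith
  linarith

end PadTS

open PadTS in
/-- The only Padovan numbers that are concatenations of two distinct repdigits are
`12, 16, 21, 28, 37, 49, 65, 86, 114, 200`. -/
theorem padovan_concat_two_distinct_repdigits
    (n d₁ d₂ ℓ₁ ℓ₂ : ℕ)
    (hd₁ : d₁ ≤ 9) (hd₂ : d₂ ≤ 9) (hne : d₁ ≠ d₂) (hd₁pos : 0 < d₁)
    (hℓ₁ : 1 ≤ ℓ₁) (hℓ₂ : 1 ≤ ℓ₂)
    (heq : padovan n = d₁ * ((10 ^ ℓ₁ - 1) / 9) * 10 ^ ℓ₂ + d₂ * ((10 ^ ℓ₂ - 1) / 9)) :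
    padovan n ∈ ({12, 16, 21, 28, 37, 49, 65, 86, 114, 200} : Set ℕ) := by
  have hrep : ∀ l : ℕ, 9 * ((10 ^ l - 1) / 9) + 1 = 10 ^ l := by
    intro l
    have h1 : 10 ^ l % 9 = 1 := by
      have : 10 ^ l ≡ 1 ^ l [MOD 9] := Nat.ModEq.pow l rfl
      rw [one_pow] at this
      exact this
    have h2 : 0 < 10 ^ l := by positivity
    omega
  have hE : EqE (padovan n) d₁ d₂ (ℓ₁ + ℓ₂) ℓ₂ := by
    constructor
    have h1 := hrep ℓ₁
    have h2 := hrep ℓ₂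
    rw [heq, pow_add]
    generalize (10 ^ ℓ₁ - 1) / 9 = s at *
    generalize (10 ^ ℓ₂ - 1) / 9 = t at *
    rw [← h1, ← h2]
    ring
  rcases Nat.lt_or_ge (ℓ₁ + ℓ₂) 5 with h5 | h5
  · have hn : n < 45 := by
      by_contra hcon
      have hlarge := padovan_large n (by omega)
      have he := hE.eq
      have hp4 : 10 ^ (ℓ₁ + ℓ₂) ≤ 10 ^ 4 := Nat.pow_le_pow_right (by norm_num) (by omega)
      have hp3 : 10 ^ ℓ₂ ≤ 10 ^ 4 := Nat.pow_le_pow_right (by norm_num) (by omega)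
      have m1 : d₁ * 10 ^ (ℓ₁ + ℓ₂) ≤ 9 * 10 ^ 4 := Nat.mul_le_mul hd₁ hp4
      have m2 : d₂ * 10 ^ ℓ₂ ≤ 9 * 10 ^ 4 := Nat.mul_le_mul hd₂ hp3
      omega
    have hs := small_true
    unfold small at hs
    have h1 := allB_spec hs n hn
    rw [force_eq] at h1
    have h2 := allB_spec (allB_spec (allB_spec (allB_spec h1 ℓ₁ (by omega)) ℓ₂ (by omega)) d₁
      (by omega)) d₂ (by omega)
    simp only [Bool.or_eq_true, Nat.beq_eq, Bool.not_eq_true', beq_ne, List.any_eq_true] at h2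
    rcases h2 with ((((h | h) | h) | h) | h) | h
    · omega
    · omega
    · omega
    · exact absurd h hne
    · exact absurd heq h
    · obtain ⟨x, hx, hx'⟩ := h
      rw [hx']
      simpa using hx
  · obtain ⟨N, u, w, hEq, hN, hM, -, hN2⟩ := sieve' hE hd₁pos hd₁ hd₂ hne h5 hℓ₂ (by omega)
    exact (final hEq hN hM hN2).elim
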